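/- arXiv:2007.06964 — 2 statements merged into one kernel-verified Lean document; each statement's English description precedes it below -/
import Mathlib

section
/- Superposition principle (converse part): Let Ω ⊂ ℝ^d be the closure of a bounded domain, v : X_Ω → ℝ^d and g : X_Ω → ℝ measurable, and let σ ∈ M⁺(𝒮_Ω) be concentrated on H_Ω^{v,g} and satisfy ∫₀¹ ∫_{𝒮_Ω} h(t)(1 + |v(t,γ(t))| + |g(t,γ(t))|) dσ(γ,h) dt < ∞. Then σ ∈ M⁺₁(𝒮_Ω), the curve t ↦ ρ_t^σ defined by ρ_t^σ(E) := ∫_{𝒮_Ω} h(t)χ_E(γ(t)) dσ(γ,h) belongs to C_w([0,1];M⁺(Ω)), and it is a measure solution of ∂_t ρ_t^σ + div(v ρ_t^σ) = g ρ_t^σ in X_Ω. -/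
open MeasureTheory Set Filter Topology
open scoped ENNReal NNReal

noncomputable section

namespace Paper

abbrev Euc (d : ℕ) : Type := EuclideanSpace ℝ (Fin d)

abbrev XX (d : ℕ) : Type := ℝ × Euc d

variable {d : ℕ}

/-- `Ω` is the closure of a bounded domain (a nonempty bounded open connected set). -/
def IsClosureOfBoundedDomain (Ω : Set (Euc d)) : Prop :=
  ∃ U : Set (Euc d), IsOpen U ∧ U.Nonempty ∧ IsConnected U ∧
    Bornology.IsBounded U ∧ Ω = closure U

/-- `Ω` is the closure of a bounded convex domain. -/
def IsClosureOfBoundedConvexDomain (Ω : Set (Euc d)) : Prop :=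
  ∃ U : Set (Euc d), IsOpen U ∧ U.Nonempty ∧ Convex ℝ U ∧
    Bornology.IsBounded U ∧ Ω = closure U

/-- clamping of `ℝ` onto `[0,1]`. -/
def clamp (t : ℝ) : ℝ := max 0 (min 1 t)

/-- `t ↦ ρ t` is a narrowly continuous curve (on `[0,1]`) of finite positive
measures concentrated on `Ω`, i.e. an element of `C_w([0,1]; M⁺(Ω))`. -/
def NarrowCurve (Ω : Set (Euc d)) (ρ : ℝ → Measure (Euc d)) : Prop :=
  (∀ t ∈ Icc (0:ℝ) 1, ρ t Ωᶜ = 0 ∧ ρ t Set.univ ≠ ⊤) ∧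
  (∀ φ : Euc d → ℝ, Continuous φ →
      ContinuousOn (fun t => ∫ x, φ x ∂(ρ t)) (Icc (0:ℝ) 1))

/-- Test functions for the continuity equation on `X_Ω = (0,1) × Ω` (no-flux form:
compact support in time, free at the spatial boundary). -/
def IsTest (φ : XX d → ℝ) : Prop :=
  ContDiff ℝ (⊤ : ℕ∞) φ ∧ HasCompactSupport φ ∧
    tsupport φ ⊆ Ioo (0:ℝ) 1 ×ˢ (Set.univ : Set (Euc d))

/-- Distributional solution of `∂ₜ ρ + div (v ρ) = g ρ`. -/
def SolvesCE (ρ : ℝ → Measure (Euc d)) (v : XX d → Euc d) (g : XX d → ℝ) : Prop :=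
  ∀ φ : XX d → ℝ, IsTest φ →
    (∫ t in Ioo (0:ℝ) 1,
      ∫ x, (fderiv ℝ φ (t, x) (1, v (t, x)) + φ (t, x) * g (t, x)) ∂(ρ t)) = 0

/-- The Hellinger–Kantorovich energy `∫₀¹ ∫ (|v|² + g²) dρ_t dt`. -/
def EnergyVG (ρ : ℝ → Measure (Euc d)) (v : XX d → Euc d) (g : XX d → ℝ) : ℝ≥0∞ :=
  ∫⁻ t in Ioo (0:ℝ) 1, ∫⁻ x, ENNReal.ofReal (‖v (t, x)‖ ^ 2 + g (t, x) ^ 2) ∂(ρ t)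

/-- The class `D_{v,g}` of finite-energy narrowly continuous solutions. -/
def Dvg (Ω : Set (Euc d)) (v : XX d → Euc d) (g : XX d → ℝ)
    (ρ : ℝ → Measure (Euc d)) : Prop :=
  NarrowCurve Ω ρ ∧ SolvesCE ρ v g ∧ EnergyVG ρ v g < ⊤

/-- total variation `‖ρ‖_{M(X_Ω)}` of `ρ = dt ⊗ ρ_t`. -/
def TVcurve (ρ : ℝ → Measure (Euc d)) : ℝ≥0∞ :=
  ∫⁻ t in Ioo (0:ℝ) 1, ρ t Set.univ

/-- The cone `𝒞_V = {h δ_γ : h ≥ 0, γ ∈ V}` of weighted Dirac masses. -/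
def coneSet (V : Set (Euc d)) : Set (Measure (Euc d)) :=
  {μ | ∃ (a : ℝ) (x : Euc d), 0 ≤ a ∧ x ∈ V ∧ μ = ENNReal.ofReal a • Measure.dirac x}

/-- The space `𝒮_V` of narrowly continuous curves `[0,1] → 𝒞_V`
(extended to `ℝ` by clamping). -/
structure SCurve (V : Set (Euc d)) where
  toFun : ℝ → Measure (Euc d)
  clamped : ∀ t, toFun t = toFun (clamp t)
  cone : ∀ t, toFun t ∈ coneSet V
  narrow : ∀ φ : Euc d → ℝ, Continuous φ → Continuous fun t => ∫ x, φ x ∂(toFun t)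

/-- The flat distance `D_F` between measures. -/
def flatDist (μ ν : Measure (Euc d)) : ℝ :=
  sSup {r : ℝ | ∃ φ : Euc d → ℝ, Continuous φ ∧ (∀ x, |φ x| ≤ 1) ∧ LipschitzWith 1 φ ∧
        r = (∫ x, φ x ∂μ) - ∫ x, φ x ∂ν}

/-- The supremum distance `D` on `𝒮_V`. -/
def Ddist {V : Set (Euc d)} (η₁ η₂ : SCurve V) : ℝ :=
  sSup {r : ℝ | ∃ t ∈ Icc (0:ℝ) 1, r = flatDist (η₁.toFun t) (η₂.toFun t)}

/-- The topology of `(𝒮_V, D)`, generated by the open `D`-balls. -/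
def Stop (V : Set (Euc d)) : TopologicalSpace (SCurve V) :=
  TopologicalSpace.generateFrom
    {s | ∃ (η₀ : SCurve V) (ε : ℝ), 0 < ε ∧ s = {η | Ddist η₀ η < ε}}

/-- The Borel σ-algebra of `(𝒮_V, D)`. -/
def Sborel (V : Set (Euc d)) : MeasurableSpace (SCurve V) := @borel _ (Stop V)

instance (V : Set (Euc d)) : MeasurableSpace (SCurve V) := Sborel V

/-- `‖h‖_∞` for a curve `ρ_t = h(t) δ_{γ(t)} ∈ 𝒮_V`. -/
def supMass {V : Set (Euc d)} (η : SCurve V) : ℝ≥0∞ :=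
  ⨆ t ∈ Icc (0:ℝ) 1, η.toFun t Set.univ

/-- `AC²[0,1]`: absolutely continuous on `[0,1]` with a.e. derivative in `L²`. -/
def AC2 {F : Type*} [NormedAddCommGroup F] [NormedSpace ℝ F] (f : ℝ → F) : Prop :=
  ∃ f' : ℝ → F, IntegrableOn f' (Icc (0:ℝ) 1) ∧
    IntegrableOn (fun t => ‖f' t‖ ^ 2) (Icc (0:ℝ) 1) ∧
    ∀ t ∈ Icc (0:ℝ) 1, f t = f 0 + ∫ s in (0:ℝ)..t, f' s

/-- `(γ, h)` represents the curve `η ∈ 𝒮_V`, i.e. `η_t = h(t) δ_{γ(t)}` on `[0,1]`. -/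
def Represents {V : Set (Euc d)} (η : SCurve V) (γ : ℝ → Euc d) (h : ℝ → ℝ) : Prop :=
  ∀ t ∈ Icc (0:ℝ) 1, 0 ≤ h t ∧ γ t ∈ V ∧
    η.toFun t = ENNReal.ofReal (h t) • Measure.dirac (γ t)

/-- The set `H_V ⊆ 𝒮_V` of curves `h(t)δ_{γ(t)}` with `h, √h ∈ AC²[0,1]`,
`√h γ ∈ AC²([0,1];ℝ^d)`. -/
def MemH (V : Set (Euc d)) (η : SCurve V) : Prop :=
  ∃ (γ : ℝ → Euc d) (h : ℝ → ℝ), Represents η γ h ∧ AC2 h ∧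
    AC2 (fun t => Real.sqrt (h t)) ∧ AC2 (fun t => Real.sqrt (h t) • γ t)

/-- The set `H_V^{v,g}`: curves in `H_V` solving the characteristic system
`γ' = v(t,γ)` a.e. on `{h>0}` and `h' = g(t,γ) h` a.e. on `(0,1)`. -/
def MemHvg (V : Set (Euc d)) (v : XX d → Euc d) (g : XX d → ℝ) (η : SCurve V) : Prop :=
  ∃ (γ : ℝ → Euc d) (h : ℝ → ℝ), Represents η γ h ∧ AC2 h ∧
    AC2 (fun t => Real.sqrt (h t)) ∧ AC2 (fun t => Real.sqrt (h t) • γ t) ∧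
    (∀ᵐ t ∂(volume.restrict {t | t ∈ Ioo (0:ℝ) 1 ∧ 0 < h t}),
        HasDerivAt γ (v (t, γ t)) t) ∧
    (∀ᵐ t ∂(volume.restrict (Ioo (0:ℝ) 1)),
        HasDerivAt h (g (t, γ t) * h t) t)

/-- The set `𝒮*_V` of curves whose positivity set `{h > 0}` is `[0,1] ∩ (-∞, τ)`. -/
def MemSstar {V : Set (Euc d)} (η : SCurve V) : Prop :=
  ∃ τ : ℝ, {t | t ∈ Icc (0:ℝ) 1 ∧ η.toFun t Set.univ ≠ 0} = Icc (0:ℝ) 1 ∩ Iio τ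

/-- The vanishing time `τ(γ,h) = min { t ∈ [0,1] : h(t) = 0 }` (`∞` if none). -/
def tauS {V : Set (Euc d)} (η : SCurve V) : ℝ≥0∞ :=
  sInf {c : ℝ≥0∞ | ∃ t ∈ Icc (0:ℝ) 1, η.toFun t Set.univ = 0 ∧ c = ENNReal.ofReal t}


open Classical in
/-- The integrand `Ψ_δ(t,x,y)`. -/
def Psi (δ : ℝ) (t : ℝ) (x : Euc d) (y : ℝ) : ℝ≥0∞ :=
  if 0 < t then ENNReal.ofReal ((‖x‖ ^ 2 + δ ^ 2 * y ^ 2) / (2 * t))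
  else if t = 0 ∧ x = 0 ∧ y = 0 then 0 else ⊤

/-- `u` is a density of the signed measure `σ` with respect to `lam`. -/
def IsDensityS (σ : SignedMeasure (XX d)) (lam : Measure (XX d)) (u : XX d → ℝ) : Prop :=
  ∀ s : Set (XX d), MeasurableSet s → σ s = ∫ x in s, u x ∂lam

/-- `w` is a density of the vector measure `m` with respect to `lam`. -/
def IsDensityV (m : VectorMeasure (XX d) (Euc d)) (lam : Measure (XX d))
    (w : XX d → Euc d) : Prop :=
  ∀ s : Set (XX d), MeasurableSet s → m s = ∫ x in s, w x ∂lam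

/-- `r` is a density of the positive measure `P` with respect to `lam`. -/
def IsDensityP (P : Measure (XX d)) (lam : Measure (XX d)) (r : XX d → ℝ) : Prop :=
  ∀ s : Set (XX d), MeasurableSet s → P s = ∫⁻ x in s, ENNReal.ofReal (r x) ∂lam

/-- `(P, m, μ)` is a measure solution of `∂ₜ ρ + div m = μ` (with `P` positive). -/
def SolvesCEMeas (P : Measure (XX d)) (m : VectorMeasure (XX d) (Euc d))
    (μ : SignedMeasure (XX d)) : Prop :=
  ∀ (lam : Measure (XX d)), IsFiniteMeasure lam →
    ∀ (w : XX d → Euc d) (u : XX d → ℝ), Measurable w → Measurable u →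
      IsDensityV m lam w → IsDensityS μ lam u →
      ∀ φ : XX d → ℝ, IsTest φ →
        ((∫ x, fderiv ℝ φ x ((1:ℝ), (0 : Euc d)) ∂P) +
          (∫ x, fderiv ℝ φ x ((0:ℝ), w x) ∂lam) + ∫ x, φ x * u x ∂lam) = 0

/-- The Wasserstein–Fisher–Rao energy `B_δ(ρ,m,μ)` for a positive `ρ`. -/
def BdeltaMeas (δ : ℝ) (P : Measure (XX d)) (m : VectorMeasure (XX d) (Euc d))
    (μ : SignedMeasure (XX d)) : ℝ≥0∞ :=
  sInf {c : ℝ≥0∞ | ∃ lam : Measure (XX d), IsFiniteMeasure lam ∧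
    ∃ (r : XX d → ℝ) (w : XX d → Euc d) (u : XX d → ℝ),
      Measurable r ∧ Measurable w ∧ Measurable u ∧ (∀ x, 0 ≤ r x) ∧
      IsDensityP P lam r ∧ IsDensityV m lam w ∧ IsDensityS μ lam u ∧
      c = ∫⁻ x, Psi δ (r x) (w x) (u x) ∂lam}

open Classical in
/-- The coercive energy `J_{α,β,δ}(ρ,m,μ)` for a positive `ρ`. -/
def JMeas (α β δ : ℝ) (P : Measure (XX d)) (m : VectorMeasure (XX d) (Euc d))
    (μ : SignedMeasure (XX d)) : ℝ≥0∞ :=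
  if SolvesCEMeas P m μ then
    ENNReal.ofReal β * BdeltaMeas δ P m μ + ENNReal.ofReal α * P Set.univ
  else ⊤

/-- `(ρ, m, μ)` is a measure solution of `∂ₜ ρ + div m = μ` (signed case). -/
def SolvesCESigned (ρ : SignedMeasure (XX d)) (m : VectorMeasure (XX d) (Euc d))
    (μ : SignedMeasure (XX d)) : Prop :=
  ∀ (lam : Measure (XX d)), IsFiniteMeasure lam →
    ∀ (r : XX d → ℝ) (w : XX d → Euc d) (u : XX d → ℝ),
      Measurable r → Measurable w → Measurable u →
      IsDensityS ρ lam r → IsDensityV m lam w → IsDensityS μ lam u →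
      ∀ φ : XX d → ℝ, IsTest φ →
        (∫ x, (fderiv ℝ φ x ((1:ℝ), (0 : Euc d)) * r x
          + fderiv ℝ φ x ((0:ℝ), w x) + φ x * u x) ∂lam) = 0

/-- The Wasserstein–Fisher–Rao energy `B_δ(ρ,m,μ)`, signed case. -/
def BdeltaSigned (δ : ℝ) (ρ : SignedMeasure (XX d)) (m : VectorMeasure (XX d) (Euc d))
    (μ : SignedMeasure (XX d)) : ℝ≥0∞ :=
  sInf {c : ℝ≥0∞ | ∃ lam : Measure (XX d), IsFiniteMeasure lam ∧
    ∃ (r : XX d → ℝ) (w : XX d → Euc d) (u : XX d → ℝ),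
      Measurable r ∧ Measurable w ∧ Measurable u ∧
      IsDensityS ρ lam r ∧ IsDensityV m lam w ∧ IsDensityS μ lam u ∧
      c = ∫⁻ x, Psi δ (r x) (w x) (u x) ∂lam}

open Classical in
/-- The coercive energy `J_{α,β,δ}(ρ,m,μ)`, signed case. -/
def JSigned (α β δ : ℝ) (ρ : SignedMeasure (XX d)) (m : VectorMeasure (XX d) (Euc d))
    (μ : SignedMeasure (XX d)) : ℝ≥0∞ :=
  if SolvesCESigned ρ m μ then
    ENNReal.ofReal β * BdeltaSigned δ ρ m μ
      + ENNReal.ofReal α * ρ.totalVariation Set.univ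
  else ⊤

/-- A signed measure on `X = ℝ × ℝ^d` is concentrated on `X_Ω = (0,1) × Ω`. -/
def ConcS (Ω : Set (Euc d)) (ρ : SignedMeasure (XX d)) : Prop :=
  ∀ s : Set (XX d), MeasurableSet s → s ⊆ (Ioo (0:ℝ) 1 ×ˢ Ω)ᶜ → ρ s = 0

/-- A vector measure on `X = ℝ × ℝ^d` is concentrated on `X_Ω = (0,1) × Ω`. -/
def ConcV (Ω : Set (Euc d)) (m : VectorMeasure (XX d) (Euc d)) : Prop :=
  ∀ s : Set (XX d), MeasurableSet s → s ⊆ (Ioo (0:ℝ) 1 ×ˢ Ω)ᶜ → m s = 0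

/-- Integral of `φ` against a signed measure. -/
def sInt {α : Type*} [MeasurableSpace α] (σ : SignedMeasure α) (φ : α → ℝ) : ℝ :=
  (∫ x, φ x ∂σ.toJordanDecomposition.posPart) -
    ∫ x, φ x ∂σ.toJordanDecomposition.negPart

/-- Triples `(ρ, m, μ) ∈ M(X_Ω) × M(X_Ω; ℝ^d) × M(X_Ω)`. -/
abbrev Mtriple (d : ℕ) : Type :=
  SignedMeasure (XX d) × VectorMeasure (XX d) (Euc d) × SignedMeasure (XX d)

/-- `P` is the measure `dt ⊗ ρ_t` associated with the curve `η ∈ 𝒮_V`. -/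
def CurveMeasure {V : Set (Euc d)} (η : SCurve V) (P : Measure (XX d)) : Prop :=
  ∀ s : Set (XX d), MeasurableSet s →
    P s = ∫⁻ t in Ioo (0:ℝ) 1, η.toFun t {x | (t, x) ∈ s}

/-- `h'` and `γ'` are the a.e. derivatives of `h` on `(0,1)` and of `γ` on `{h>0}`. -/
def HasAEDerivs (γ : ℝ → Euc d) (h : ℝ → ℝ) (γ' : ℝ → Euc d) (h' : ℝ → ℝ) : Prop :=
  (∀ᵐ t ∂(volume.restrict (Ioo (0:ℝ) 1)), HasDerivAt h (h' t) t) ∧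
  (∀ᵐ t ∂(volume.restrict {t | t ∈ Ioo (0:ℝ) 1 ∧ 0 < h t}), HasDerivAt γ (γ' t) t)

/-- The triple `p = (ρ, m, μ)` is of characteristic form
`ρ = h dt ⊗ δ_γ`, `m = γ' ρ`, `μ = h' dt ⊗ δ_γ` with the regularity of `H_Ω`. -/
def CharRepr (Ω : Set (Euc d)) (γ : ℝ → Euc d) (h : ℝ → ℝ) (γ' : ℝ → Euc d)
    (h' : ℝ → ℝ) (p : Mtriple d) : Prop :=
  (∀ t ∈ Icc (0:ℝ) 1, 0 ≤ h t ∧ γ t ∈ Ω) ∧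
  AC2 h ∧ AC2 (fun t => Real.sqrt (h t)) ∧ AC2 (fun t => Real.sqrt (h t) • γ t) ∧
  (∀ φ : Euc d → ℝ, Continuous φ →
      ContinuousOn (fun t => h t * φ (γ t)) (Icc (0:ℝ) 1)) ∧
  HasAEDerivs γ h γ' h' ∧
  (∀ s : Set (XX d), MeasurableSet s →
      p.1 s = ∫ t in Ioo (0:ℝ) 1, Set.indicator {u : ℝ | (u, γ u) ∈ s} h t) ∧
  (∀ s : Set (XX d), MeasurableSet s →
      p.2.1 s = ∫ t in Ioo (0:ℝ) 1,
        Set.indicator {u : ℝ | (u, γ u) ∈ s} (fun u => h u • γ' u) t) ∧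
  (∀ s : Set (XX d), MeasurableSet s →
      p.2.2 s = ∫ t in Ioo (0:ℝ) 1, Set.indicator {u : ℝ | (u, γ u) ∈ s} h' t)

/-- The set `𝒞` of extremal characteristic triples. -/
def MemC (α β δ : ℝ) (Ω : Set (Euc d)) (p : Mtriple d) : Prop :=
  ∃ (γ : ℝ → Euc d) (h : ℝ → ℝ) (γ' : ℝ → Euc d) (h' : ℝ → ℝ),
    CharRepr Ω γ h γ' h' p ∧
    IsPreconnected {t | t ∈ Icc (0:ℝ) 1 ∧ 0 < h t} ∧
    JSigned α β δ p.1 p.2.1 p.2.2 = 1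


/-- Curves in `C_w([0,1]; M(Ω))`: narrowly continuous curves of signed measures
concentrated on `Ω`, extended to `ℝ` by clamping. -/
def IsCwCurve (Ω : Set (Euc d)) (f : ℝ → SignedMeasure (Euc d)) : Prop :=
  (∀ t, f t = f (clamp t)) ∧
  (∀ t, ∀ s : Set (Euc d), MeasurableSet s → s ⊆ Ωᶜ → f t s = 0) ∧
  (∀ φ : Euc d → ℝ, Continuous φ → Continuous fun t => sInt (f t) φ)

/-- `r` is a density with respect to `lam` of the measure `dt ⊗ f_t` on `X`. -/
def CwDensity (f : ℝ → SignedMeasure (Euc d)) (lam : Measure (XX d))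
    (r : XX d → ℝ) : Prop :=
  ∀ s : Set (XX d), MeasurableSet s →
    (∫ t in Ioo (0:ℝ) 1,
        sInt (f t) ({x : Euc d | (t, x) ∈ s}.indicator fun _ => (1:ℝ)))
      = ∫ x in s, r x ∂lam

/-- `(f, m, μ)` is a measure solution of `∂ₜ ρ + div m = μ`, `f` a curve. -/
def SolvesCECw (f : ℝ → SignedMeasure (Euc d)) (m : VectorMeasure (XX d) (Euc d))
    (μ : SignedMeasure (XX d)) : Prop :=
  ∀ (lam : Measure (XX d)), IsFiniteMeasure lam →
    ∀ (w : XX d → Euc d) (u : XX d → ℝ), Measurable w → Measurable u →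
      IsDensityV m lam w → IsDensityS μ lam u →
      ∀ φ : XX d → ℝ, IsTest φ →
        ((∫ t in Ioo (0:ℝ) 1, sInt (f t) fun x => fderiv ℝ φ (t, x) ((1:ℝ), (0 : Euc d)))
          + (∫ x, fderiv ℝ φ x ((0:ℝ), w x) ∂lam) + ∫ x, φ x * u x ∂lam) = 0

/-- `B_δ(dt ⊗ f_t, m, μ)`. -/
def BdeltaCw (δ : ℝ) (f : ℝ → SignedMeasure (Euc d)) (m : VectorMeasure (XX d) (Euc d))
    (μ : SignedMeasure (XX d)) : ℝ≥0∞ :=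
  sInf {c : ℝ≥0∞ | ∃ lam : Measure (XX d), IsFiniteMeasure lam ∧
    ∃ (r : XX d → ℝ) (w : XX d → Euc d) (u : XX d → ℝ),
      Measurable r ∧ Measurable w ∧ Measurable u ∧
      CwDensity f lam r ∧ IsDensityV m lam w ∧ IsDensityS μ lam u ∧
      c = ∫⁻ x, Psi δ (r x) (w x) (u x) ∂lam}

/-- `‖dt ⊗ f_t‖_{M(X_Ω)}`. -/
def TVCw (f : ℝ → SignedMeasure (Euc d)) : ℝ≥0∞ :=
  ∫⁻ t in Ioo (0:ℝ) 1, (f t).totalVariation Set.univ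

open Classical in
/-- `J_{α,β,δ}(dt ⊗ f_t, m, μ)`. -/
def JCw (α β δ : ℝ) (f : ℝ → SignedMeasure (Euc d)) (m : VectorMeasure (XX d) (Euc d))
    (μ : SignedMeasure (XX d)) : ℝ≥0∞ :=
  if SolvesCECw f m μ then
    ENNReal.ofReal β * BdeltaCw δ f m μ + ENNReal.ofReal α * TVCw f
  else ⊤

/-- The set `𝒞` in curve form: `(f, m, μ)` with `f_t = h(t) δ_{γ(t)}`,
`m = h γ' dt ⊗ δ_γ`, `μ = h' dt ⊗ δ_γ`, with `H_Ω`-regularity, connected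
positivity set and unit energy. -/
def MemCCw (α β δ : ℝ) (Ω : Set (Euc d)) (f : ℝ → SignedMeasure (Euc d))
    (m : VectorMeasure (XX d) (Euc d)) (μ : SignedMeasure (XX d)) : Prop :=
  ∃ (γ : ℝ → Euc d) (h : ℝ → ℝ) (γ' : ℝ → Euc d) (h' : ℝ → ℝ),
    (∀ t ∈ Icc (0:ℝ) 1, 0 ≤ h t ∧ γ t ∈ Ω) ∧
    AC2 h ∧ AC2 (fun t => Real.sqrt (h t)) ∧ AC2 (fun t => Real.sqrt (h t) • γ t) ∧
    (∀ φ : Euc d → ℝ, Continuous φ →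
        ContinuousOn (fun t => h t * φ (γ t)) (Icc (0:ℝ) 1)) ∧
    HasAEDerivs γ h γ' h' ∧
    (∀ t, f t = h (clamp t) • (Measure.dirac (γ (clamp t))).toSignedMeasure) ∧
    (∀ s : Set (XX d), MeasurableSet s →
        m s = ∫ t in Ioo (0:ℝ) 1,
          Set.indicator {u : ℝ | (u, γ u) ∈ s} (fun u => h u • γ' u) t) ∧
    (∀ s : Set (XX d), MeasurableSet s →
        μ s = ∫ t in Ioo (0:ℝ) 1, Set.indicator {u : ℝ | (u, γ u) ∈ s} h' t) ∧
    IsPreconnected {t | t ∈ Icc (0:ℝ) 1 ∧ 0 < h t} ∧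
    JCw α β δ f m μ = 1

/-- The mollified density `ρ_t ∗ ξ_ε + ε χ_V`. -/
def mollDens (V : Set (Euc d)) (ρ : ℝ → Measure (Euc d)) (ξ : Euc d → ℝ) (ε : ℝ)
    (t : ℝ) (x : Euc d) : ℝ :=
  (∫ y, (ε ^ d)⁻¹ * ξ (ε⁻¹ • (x - y)) ∂(ρ t)) + ε * V.indicator (fun _ => (1:ℝ)) x

/-- The mollified measure `ρ_t^ε = (ρ_t ∗ ξ_ε + ε χ_V) dx`. -/
def mollRho (V : Set (Euc d)) (ρ : ℝ → Measure (Euc d)) (ξ : Euc d → ℝ) (ε : ℝ) :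
    ℝ → Measure (Euc d) :=
  fun t => volume.withDensity fun x => ENNReal.ofReal (mollDens V ρ ξ ε t x)

open Classical in
/-- The mollified velocity field `v^ε = ((v ρ_t) ∗ ξ_ε) / ρ_t^ε`. -/
def mollV (V : Set (Euc d)) (ρ : ℝ → Measure (Euc d)) (v : XX d → Euc d)
    (ξ : Euc d → ℝ) (ε : ℝ) : XX d → Euc d :=
  fun p => if mollDens V ρ ξ ε p.1 p.2 = 0 then 0 else
    (mollDens V ρ ξ ε p.1 p.2)⁻¹ •
      ∫ y, ((ε ^ d)⁻¹ * ξ (ε⁻¹ • (p.2 - y))) • v (p.1, y) ∂(ρ p.1)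

open Classical in
/-- The mollified growth field `g^ε = ((g ρ_t) ∗ ξ_ε) / ρ_t^ε`. -/
def mollG (V : Set (Euc d)) (ρ : ℝ → Measure (Euc d)) (g : XX d → ℝ)
    (ξ : Euc d → ℝ) (ε : ℝ) : XX d → ℝ :=
  fun p => if mollDens V ρ ξ ε p.1 p.2 = 0 then 0 else
    (mollDens V ρ ξ ε p.1 p.2)⁻¹ *
      ∫ y, ((ε ^ d)⁻¹ * ξ (ε⁻¹ • (p.2 - y))) * g (p.1, y) ∂(ρ p.1)



lemma toFun_finite {V : Set (Euc d)} (η : SCurve V) (t : ℝ) :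
    IsFiniteMeasure (η.toFun t) := by
  obtain ⟨a, x, ha, hx, h⟩ := η.cone t
  rw [h]
  constructor
  simp

instance instFiniteToFun {V : Set (Euc d)} (η : SCurve V) (t : ℝ) :
    IsFiniteMeasure (η.toFun t) := toFun_finite η t

lemma clamp_mem (t : ℝ) : clamp t ∈ Icc (0:ℝ) 1 := by
  unfold clamp
  constructor
  · exact le_max_left _ _
  · exact max_le (by norm_num) (min_le_left _ _)

lemma abs_integral_le_mass (μ : Measure (Euc d)) [IsFiniteMeasure μ] {φ : Euc d → ℝ}
    (hφ : ∀ x, |φ x| ≤ 1) : |∫ x, φ x ∂μ| ≤ μ.real univ := by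
  have := norm_integral_le_of_norm_le_const (μ := μ) (f := φ) (C := 1)
    (Eventually.of_forall hφ)
  simpa using this

lemma flat_set_le (μ ν : Measure (Euc d)) [IsFiniteMeasure μ] [IsFiniteMeasure ν] {r : ℝ}
    (hr : r ∈ {r : ℝ | ∃ φ : Euc d → ℝ, Continuous φ ∧ (∀ x, |φ x| ≤ 1) ∧ LipschitzWith 1 φ ∧
        r = (∫ x, φ x ∂μ) - ∫ x, φ x ∂ν}) : r ≤ μ.real univ + ν.real univ := by
  obtain ⟨φ, hc, hb, hl, rfl⟩ := hr
  have h1 := abs_le.1 (abs_integral_le_mass μ hb)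
  have h2 := abs_le.1 (abs_integral_le_mass ν hb)
  linarith [h1.2, h2.1]

lemma flatDist_le (μ ν : Measure (Euc d)) [IsFiniteMeasure μ] [IsFiniteMeasure ν] :
    flatDist μ ν ≤ μ.real univ + ν.real univ :=
  Real.sSup_le (fun _ hr => flat_set_le μ ν hr) (by positivity)

lemma le_flatDist (μ ν : Measure (Euc d)) [IsFiniteMeasure μ] [IsFiniteMeasure ν]
    {φ : Euc d → ℝ} (hc : Continuous φ) (hb : ∀ x, |φ x| ≤ 1) (hl : LipschitzWith 1 φ) :
    |(∫ x, φ x ∂μ) - ∫ x, φ x ∂ν| ≤ flatDist μ ν := by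
  have bdd : BddAbove {r : ℝ | ∃ φ : Euc d → ℝ, Continuous φ ∧ (∀ x, |φ x| ≤ 1) ∧
      LipschitzWith 1 φ ∧ r = (∫ x, φ x ∂μ) - ∫ x, φ x ∂ν} :=
    ⟨_, fun _ hr => flat_set_le μ ν hr⟩
  rw [abs_le']
  constructor
  · exact le_csSup bdd ⟨φ, hc, hb, hl, rfl⟩
  · refine le_csSup bdd ⟨fun x => - φ x, hc.neg, by simpa using hb, ?_, ?_⟩
    · exact LipschitzWith.of_dist_le_mul fun x y => by
        simpa [dist_neg_neg] using hl.dist_le_mul x y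
    · rw [integral_neg, integral_neg]; ring

lemma le_Ddist {V : Set (Euc d)} (η₁ η₂ : SCurve V) {t : ℝ} (ht : t ∈ Icc (0:ℝ) 1) :
    flatDist (η₁.toFun t) (η₂.toFun t) ≤ Ddist η₁ η₂ := by
  have mass : ∀ η : SCurve V, ∃ C, ∀ t ∈ Icc (0:ℝ) 1, (η.toFun t).real univ ≤ C := by
    intro η
    have hc := η.narrow (fun _ => 1) continuous_const
    obtain ⟨C, hC⟩ := isCompact_Icc.exists_bound_of_continuousOn (s := Icc (0:ℝ) 1) hc.continuousOn
    refine ⟨C, fun t ht => ?_⟩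
    have := hC t ht
    simp only [integral_const, smul_eq_mul, mul_one, Real.norm_eq_abs] at this
    exact (le_abs_self _).trans this
  obtain ⟨C1, h1⟩ := mass η₁
  obtain ⟨C2, h2⟩ := mass η₂
  refine le_csSup ⟨C1 + C2, ?_⟩ ⟨t, ht, rfl⟩
  rintro r ⟨s, hs, rfl⟩
  exact (flatDist_le _ _).trans (add_le_add (h1 s hs) (h2 s hs))

lemma measurable_integral_lip {V : Set (Euc d)} (t : ℝ) {φ : Euc d → ℝ}
    (hc : Continuous φ) (hb : ∀ x, |φ x| ≤ 1) (hl : LipschitzWith 1 φ) :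
    Measurable (fun η : SCurve V => ∫ x, φ x ∂(η.toFun t)) := by
  refine measurable_of_Ioi fun a => ?_
  have hopen : @IsOpen _ (Stop V) ((fun η : SCurve V => ∫ x, φ x ∂(η.toFun t)) ⁻¹' Ioi a) := by
    have : ((fun η : SCurve V => ∫ x, φ x ∂(η.toFun t)) ⁻¹' Ioi a) =
        ⋃₀ {s | (∃ (η₀ : SCurve V) (ε : ℝ), 0 < ε ∧ s = {η | Ddist η₀ η < ε}) ∧
          s ⊆ (fun η : SCurve V => ∫ x, φ x ∂(η.toFun t)) ⁻¹' Ioi a} := by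
      ext η₀
      constructor
      · intro h
        have h' : a < ∫ x, φ x ∂(η₀.toFun t) := h
        refine ⟨{η | Ddist η₀ η < (∫ x, φ x ∂(η₀.toFun t)) - a},
          ⟨⟨η₀, _, sub_pos.2 h', rfl⟩, ?_⟩, ?_⟩
        · intro η hη
          have hη' : Ddist η₀ η < (∫ x, φ x ∂(η₀.toFun t)) - a := hη
          have h1 := (le_flatDist (η₀.toFun (clamp t)) (η.toFun (clamp t)) hc hb hl).trans
            (le_Ddist η₀ η (clamp_mem t))
          rw [← η₀.clamped, ← η.clamped] at h1
          have h2 := le_abs_self ((∫ x, φ x ∂(η₀.toFun t)) - ∫ x, φ x ∂(η.toFun t))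
          show a < _
          linarith
        · have h0 : Ddist η₀ η₀ ≤ 0 := by
            apply Real.sSup_le _ le_rfl
            rintro r ⟨s, -, rfl⟩
            apply Real.sSup_le _ le_rfl
            rintro r ⟨φ, -, -, -, rfl⟩
            simp
          exact lt_of_le_of_lt h0 (sub_pos.2 h')
      · rintro ⟨s, ⟨-, hs⟩, h⟩
        exact hs h
    rw [this]
    apply @isOpen_sUnion _ (Stop V)
    rintro s ⟨hs, -⟩
    exact TopologicalSpace.isOpen_generateFrom_of_mem hs
  exact MeasurableSpace.measurableSet_generateFrom hopen

lemma measurable_toFun (V : Set (Euc d)) :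
    Measurable (fun p : ℝ × SCurve V => p.2.toFun p.1) := by
  have key : ∀ s : Set (Euc d), IsClosed s →
      Measurable fun p : ℝ × SCurve V => p.2.toFun p.1 s := by
    intro s hs
    have pos : ∀ n : ℕ, 0 < 1 / ((n:ℝ) + 1) := fun n => by positivity
    refine measurable_of_tendsto_metrizable
      (f := fun (n : ℕ) (p : ℝ × SCurve V) =>
        ∫⁻ x, (thickenedIndicator (pos n) s x : ℝ≥0∞) ∂(p.2.toFun p.1)) ?_ ?_
    · intro n
      set φ : Euc d → ℝ := fun x => 1 / ((n:ℝ) + 1) * (thickenedIndicator (pos n) s x : ℝ) with hφ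
      have hn1 : 1 / ((n:ℝ) + 1) ≤ 1 := by
        rw [div_le_one (by positivity)]; linarith [(Nat.cast_nonneg n : (0:ℝ) ≤ n)]
      have hti : ∀ x, (thickenedIndicator (pos n) s x : ℝ) ≤ 1 := fun x => by
        exact_mod_cast thickenedIndicator_le_one (pos n) s x
      have hcont : Continuous φ := by
        have := (thickenedIndicator (pos n) s).continuous
        fun_prop
      have hlip : LipschitzWith 1 φ := by
        refine LipschitzWith.of_dist_le_mul fun x y => ?_
        have h := (lipschitzWith_thickenedIndicator (pos n) s).dist_le_mul x y
        rw [NNReal.dist_eq] at h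
        simp only [hφ, Real.dist_eq, ← mul_sub, abs_mul, abs_of_pos (pos n)]
        rw [NNReal.coe_inv, Real.coe_toNNReal _ (pos n).le] at h
        calc _ ≤ 1 / ((n:ℝ) + 1) * ((1 / ((n:ℝ) + 1))⁻¹ * dist x y) := by gcongr
          _ = _ := by field_simp; simp
      have hb : ∀ x, |φ x| ≤ 1 := fun x => by
        simp only [hφ]
        rw [abs_of_nonneg (by positivity)]
        exact mul_le_one₀ hn1 (by positivity) (hti x)
      have hm : Measurable (Function.uncurry
          fun (t : ℝ) (η : SCurve V) => ∫ x, φ x ∂(η.toFun t)) :=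
        measurable_uncurry_of_continuous_of_measurable (fun η => η.narrow φ hcont)
          (fun t => measurable_integral_lip t hcont hb hlip)
      have heq : (fun (p : ℝ × SCurve V) =>
          ∫⁻ x, (thickenedIndicator (pos n) s x : ℝ≥0∞) ∂(p.2.toFun p.1)) =
          fun p => ENNReal.ofReal (((n:ℝ) + 1) * ∫ x, φ x ∂(p.2.toFun p.1)) := by
        funext p
        simp only [hφ]
        rw [integral_const_mul, ← mul_assoc, mul_one_div_cancel (by positivity), one_mul,
          ofReal_integral_eq_lintegral_ofReal]
        · simp
        · exact integrable_thickenedIndicator s (pos n)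
        · exact Eventually.of_forall fun x => by positivity
      rw [heq]
      exact (hm.const_mul _).ennreal_ofReal
    · rw [tendsto_pi_nhds]
      intro p
      exact tendsto_lintegral_thickenedIndicator_of_isClosed _ hs pos
        tendsto_one_div_add_atTop_nhds_zero_nat
  refine Measurable.measure_of_isPiSystem (S := {s | IsClosed s}) ?_ ?_ (fun s hs => key s hs)
    (key _ isClosed_univ)
  · rw [← borel_eq_generateFrom_isClosed]; exact BorelSpace.measurable_eq
  · exact isPiSystem_isClosed

/-- the kernel `(t, η) ↦ η_t` -/
def kap (V : Set (Euc d)) : ProbabilityTheory.Kernel (ℝ × SCurve V) (Euc d) :=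
  ⟨fun p => p.2.toFun p.1, measurable_toFun V⟩

lemma kap_apply {V : Set (Euc d)} (t : ℝ) (η : SCurve V) : kap V (t, η) = η.toFun t := rfl

lemma sfinite_of_finite {α β : Type*} [MeasurableSpace α] [MeasurableSpace β]
    (κ : ProbabilityTheory.Kernel α β) (hκ : ∀ a, κ a univ ≠ ⊤) :
    ProbabilityTheory.IsSFiniteKernel κ := by
  have hm : Measurable fun a => κ a univ := κ.measurable_coe MeasurableSet.univ
  let κ' : ProbabilityTheory.Kernel α β :=
    ⟨fun a => (κ a univ)⁻¹ • κ a, by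
      refine Measure.measurable_of_measurable_coe _ fun s hs => ?_
      simp only [Measure.smul_apply, smul_eq_mul]
      exact hm.inv.mul (κ.measurable_coe hs)⟩
  have hfin : ProbabilityTheory.IsFiniteKernel κ' := by
    refine ⟨1, by simp, fun a => ?_⟩
    show (κ a univ)⁻¹ * κ a univ ≤ 1
    exact ENNReal.inv_mul_le_one _
  have hunc : Measurable (Function.uncurry fun (a : α) (_ : β) => κ a univ) :=
    hm.comp measurable_fst
  have : κ = ProbabilityTheory.Kernel.withDensity κ' (fun a _ => κ a univ) := by
    ext a s hs
    rw [ProbabilityTheory.Kernel.withDensity_apply' _ hunc]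
    simp only [lintegral_const, MeasurableSet.univ, Measure.restrict_apply, univ_inter]
    show _ = κ a univ * ((κ a univ)⁻¹ * κ a s)
    by_cases h0 : κ a univ = 0
    · have : κ a s = 0 := measure_mono_null (subset_univ _) h0
      simp [h0, this]
    · rw [← mul_assoc, ENNReal.mul_inv_cancel h0 (hκ a), one_mul]
  rw [this]
  exact ProbabilityTheory.Kernel.IsSFiniteKernel.withDensity κ' fun a _ => hκ a

instance instSFkap (V : Set (Euc d)) : ProbabilityTheory.IsSFiniteKernel (kap V) :=
  sfinite_of_finite _ fun p => by
    have := toFun_finite p.2 p.1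
    exact measure_ne_top (p.2.toFun p.1) univ

lemma AC2.incr {F : Type*} [NormedAddCommGroup F] [NormedSpace ℝ F] {f : ℝ → F}
    (hf : AC2 f) : ∃ k : ℝ → ℝ, IntervalIntegrable k volume 0 1 ∧
      ∀ s ∈ Icc (0:ℝ) 1, ∀ t ∈ Icc (0:ℝ) 1, s ≤ t → ‖f t - f s‖ ≤ ∫ u in s..t, k u := by
  obtain ⟨f', hi, -, hf'⟩ := hf
  have hii : IntervalIntegrable f' volume 0 1 :=
    (intervalIntegrable_iff_integrableOn_Icc_of_le zero_le_one).2 hi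
  refine ⟨fun t => ‖f' t‖, hii.norm, fun s hs t ht hst => ?_⟩
  have h0s : IntervalIntegrable f' volume 0 s := hii.mono_set (by
    rw [uIcc_of_le hs.1, uIcc_of_le zero_le_one]; exact Icc_subset_Icc_right hs.2)
  have h0t : IntervalIntegrable f' volume 0 t := hii.mono_set (by
    rw [uIcc_of_le ht.1, uIcc_of_le zero_le_one]; exact Icc_subset_Icc_right ht.2)
  rw [hf' t ht, hf' s hs, add_sub_add_left_eq_sub,
    intervalIntegral.integral_interval_sub_left h0t h0s]
  exact intervalIntegral.norm_integral_le_integral_norm hst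

lemma sub_intervalIntegrable {k : ℝ → ℝ} (hk : IntervalIntegrable k volume 0 1) {s t : ℝ}
    (hs : s ∈ Icc (0:ℝ) 1) (ht : t ∈ Icc (0:ℝ) 1) : IntervalIntegrable k volume s t :=
  hk.mono_set (by
    rw [uIcc_of_le zero_le_one]; exact (ordConnected_Icc).uIcc_subset hs ht)

lemma ac_of_incr {F k : ℝ → ℝ} (hk : IntervalIntegrable k volume 0 1)
    (hF : ∀ s ∈ Icc (0:ℝ) 1, ∀ t ∈ Icc (0:ℝ) 1, s ≤ t → |F t - F s| ≤ ∫ u in s..t, k u)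
    {a b : ℝ} (ha : a ∈ Icc (0:ℝ) 1) (hb : b ∈ Icc (0:ℝ) 1) :
    AbsolutelyContinuousOnInterval F a b := by
  have hsub : uIcc a b ⊆ Icc 0 1 := (ordConnected_Icc).uIcc_subset ha hb
  have hK := (sub_intervalIntegrable hk ha hb).absolutelyContinuousOnInterval_intervalIntegral
    (c := a) left_mem_uIcc
  rw [absolutelyContinuousOnInterval_iff] at hK ⊢
  intro ε hε
  obtain ⟨δ, hδ, H⟩ := hK ε hε
  refine ⟨δ, hδ, fun E hE hE2 => lt_of_le_of_lt ?_ (H E hE hE2)⟩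
  refine Finset.sum_le_sum fun i hi => ?_
  obtain ⟨h1, h2⟩ := hE.1 i hi
  have gen : ∀ x ∈ uIcc a b, ∀ y ∈ uIcc a b, x ≤ y →
      dist (F x) (F y) ≤ dist (∫ v in a..x, k v) (∫ v in a..y, k v) := by
    intro x hx y hy hxy
    rw [dist_comm (F x), dist_comm (∫ v in a..x, k v), Real.dist_eq, Real.dist_eq,
      intervalIntegral.integral_interval_sub_left
      (sub_intervalIntegrable hk ha (hsub hy)) (sub_intervalIntegrable hk ha (hsub hx))]
    exact (hF x (hsub hx) y (hsub hy) hxy).trans (le_abs_self _)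
  rcases le_total (E.2 i).1 (E.2 i).2 with h | h
  · exact gen _ h1 _ h2 h
  · rw [dist_comm, dist_comm (∫ v in a..(E.2 i).1, k v)]
    exact gen _ h2 _ h1 h

lemma ftc_ac {F k D : ℝ → ℝ} (hk : IntervalIntegrable k volume 0 1)
    (hF : ∀ s ∈ Icc (0:ℝ) 1, ∀ t ∈ Icc (0:ℝ) 1, s ≤ t → |F t - F s| ≤ ∫ u in s..t, k u)
    (hD : ∀ᵐ t ∂(volume.restrict (Ioo (0:ℝ) 1)), HasDerivAt F (D t) t)
    {a b : ℝ} (ha : a ∈ Icc (0:ℝ) 1) (hb : b ∈ Icc (0:ℝ) 1) :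
    ∫ t in a..b, D t = F b - F a := by
  rw [← (ac_of_incr hk hF ha hb).integral_deriv_eq_sub]
  refine intervalIntegral.integral_congr_ae ?_
  rw [Measure.restrict_congr_set Ioo_ae_eq_Ioc, ae_restrict_iff' measurableSet_Ioc] at hD
  filter_upwards [hD] with t ht hmem
  refine ((ht ?_).deriv).symm
  rcases le_total a b with h | h
  · rw [uIoc_of_le h] at hmem
    exact ⟨ha.1.trans_lt hmem.1, hmem.2.trans hb.2⟩
  · rw [uIoc_of_ge h] at hmem
    exact ⟨hb.1.trans_lt hmem.1, hmem.2.trans ha.2⟩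

/-- the integrated bound along a curve -/
def Bfun {V : Set (Euc d)} (v : XX d → Euc d) (g : XX d → ℝ) (η : SCurve V) : ℝ≥0∞ :=
  ∫⁻ t in Ioo (0:ℝ) 1, ∫⁻ x, ENNReal.ofReal (1 + ‖v (t, x)‖ + |g (t, x)|) ∂(η.toFun t)

lemma supMass_le {V : Set (Euc d)} {v : XX d → Euc d} {g : XX d → ℝ} {η : SCurve V}
    (hη : MemHvg V v g η) : supMass η ≤ Bfun v g η := by
  obtain ⟨γ, h, hrep, hh, -, -, -, hder⟩ := hη
  obtain ⟨k, hk, hkh⟩ := hh.incr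
  refine iSup₂_le fun t ht => ?_
  have e1 : η.toFun t univ = ENNReal.ofReal (h t) := by
    rw [(hrep t ht).2.2]; simp
  rw [e1]
  set C : ℝ≥0∞ := ∫⁻ s in Ioo (0:ℝ) 1, ‖g (s, γ s) * h s‖ₑ with hC
  have hpt : ∀ s ∈ Ioo (0:ℝ) 1, ENNReal.ofReal (h t) ≤ ENNReal.ofReal (h s) + C := by
    intro s hs
    have hs' := Ioo_subset_Icc_self hs
    have h1 := ftc_ac hk hkh hder hs' ht
    have h2 : ‖h t - h s‖ₑ ≤ C := by
      rw [← h1]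
      rw [← ofReal_norm, intervalIntegral.norm_intervalIntegral_eq, ofReal_norm]
      refine (enorm_integral_le_lintegral_enorm _).trans ?_
      rw [hC, Measure.restrict_congr_set (Ioo_ae_eq_Ioc (μ := volume) (a := (0:ℝ)) (b := 1))]
      refine lintegral_mono_set ?_
      rw [← uIoc_of_le (zero_le_one : (0:ℝ) ≤ 1)]
      refine uIoc_subset_uIoc_of_uIcc_subset_uIcc ?_
      rw [uIcc_of_le (zero_le_one : (0:ℝ) ≤ 1)]
      exact (ordConnected_Icc).uIcc_subset hs' ht
    calc ENNReal.ofReal (h t) = ENNReal.ofReal (h s + (h t - h s)) := by ring_nf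
      _ ≤ ENNReal.ofReal (h s) + ENNReal.ofReal (h t - h s) := ENNReal.ofReal_add_le
      _ ≤ _ := by gcongr; exact (Real.ofReal_le_enorm _).trans h2
  have hvol : volume (Ioo (0:ℝ) 1) = 1 := by simp
  calc ENNReal.ofReal (h t) = ∫⁻ s in Ioo (0:ℝ) 1, ENNReal.ofReal (h t) := by simp
    _ ≤ ∫⁻ s in Ioo (0:ℝ) 1, (ENNReal.ofReal (h s) + C) :=
        setLIntegral_mono' measurableSet_Ioo hpt
    _ = (∫⁻ s in Ioo (0:ℝ) 1, ENNReal.ofReal (h s)) + C := by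
        rw [lintegral_add_right _ measurable_const]; simp
    _ ≤ ∫⁻ s in Ioo (0:ℝ) 1, (ENNReal.ofReal (h s) + ‖g (s, γ s) * h s‖ₑ) := le_lintegral_add _ _
    _ ≤ _ := by
        refine setLIntegral_mono' measurableSet_Ioo fun s hs => ?_
        obtain ⟨h0, -, he⟩ := hrep s (Ioo_subset_Icc_self hs)
        rw [he, lintegral_smul_measure, lintegral_dirac, smul_eq_mul,
          ← ENNReal.ofReal_mul h0, Real.enorm_eq_ofReal_abs,
          ← ENNReal.ofReal_add h0 (abs_nonneg _)]
        apply ENNReal.ofReal_le_ofReal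
        rw [abs_mul, abs_of_nonneg h0]
        nlinarith [norm_nonneg (v (s, γ s)), mul_nonneg h0 (norm_nonneg (v (s, γ s)))]

lemma curve_solves {V : Set (Euc d)} (hV : Bornology.IsBounded V)
    {v : XX d → Euc d} {g : XX d → ℝ} {η : SCurve V}
    (hη : MemHvg V v g η) {φ : XX d → ℝ} (hφ : IsTest φ) :
    (∫ t in Ioo (0:ℝ) 1,
      ∫ x, (fderiv ℝ φ (t, x) (1, v (t, x)) + φ (t, x) * g (t, x)) ∂(η.toFun t)) = 0 := by
  obtain ⟨γ, h, hrep, hh, hr, hp, hγder, hder⟩ := hη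
  obtain ⟨hsm, hcs, hts⟩ := hφ
  obtain ⟨R, hR⟩ := hV.exists_norm_le
  obtain ⟨L, hL⟩ := hsm.lipschitzWith_of_hasCompactSupport hcs (by simp)
  obtain ⟨M, hM⟩ := hsm.continuous.bounded_above_of_compact_support hcs
  obtain ⟨k1, hk1, hkh⟩ := hh.incr
  obtain ⟨k2, hk2, hkr⟩ := hr.incr
  obtain ⟨k3, hk3, hkp⟩ := hp.incr
  have hM0 : 0 ≤ M := (norm_nonneg _).trans (hM 0)
  -- continuity of `h`
  have hhcont : ContinuousOn h (Icc 0 1) := by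
    have := (ac_of_incr hk1 hkh (left_mem_Icc.2 zero_le_one)
      (right_mem_Icc.2 zero_le_one)).continuousOn
    rwa [uIcc_of_le zero_le_one] at this
  have hrcont : ContinuousOn (fun t => Real.sqrt (h t)) (Icc 0 1) :=
    Real.continuous_sqrt.comp_continuousOn hhcont
  obtain ⟨Q, hQ⟩ := isCompact_Icc.exists_bound_of_continuousOn hrcont
  obtain ⟨P, hP⟩ := isCompact_Icc.exists_bound_of_continuousOn hhcont
  have hQ0 : 0 ≤ Q := (norm_nonneg _).trans (hQ 0 (left_mem_Icc.2 zero_le_one))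
  have hP0 : 0 ≤ P := (norm_nonneg _).trans (hP 0 (left_mem_Icc.2 zero_le_one))
  set F : ℝ → ℝ := fun t => h t * φ (t, γ t) with hFdef
  set k : ℝ → ℝ := fun u => M * k1 u + L * P + L * Q * k3 u + L * Q * R * k2 u with hkdef
  have hk : IntervalIntegrable k volume 0 1 :=
    (((hk1.const_mul M).add intervalIntegrable_const).add (hk3.const_mul _)).add
      (hk2.const_mul _)
  have hF : ∀ s ∈ Icc (0:ℝ) 1, ∀ t ∈ Icc (0:ℝ) 1, s ≤ t →
      |F t - F s| ≤ ∫ u in s..t, k u := by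
    intro s hs t ht hst
    have i1 := sub_intervalIntegrable hk1 hs ht
    have i2 := sub_intervalIntegrable hk2 hs ht
    have i3 := sub_intervalIntegrable hk3 hs ht
    have e : ∫ u in s..t, k u = M * (∫ u in s..t, k1 u) + L * P * (t - s)
        + L * Q * (∫ u in s..t, k3 u) + L * Q * R * (∫ u in s..t, k2 u) := by
      simp only [hkdef]
      rw [intervalIntegral.integral_add
          (((i1.const_mul M).add intervalIntegrable_const).add (i3.const_mul _)) (i2.const_mul _),
        intervalIntegral.integral_add
          ((i1.const_mul M).add intervalIntegrable_const) (i3.const_mul _),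
        intervalIntegral.integral_add (i1.const_mul M) intervalIntegrable_const]
      simp
      ring
    rw [e]
    have a1 := hkh s hs t ht hst
    have a2 := hkr s hs t ht hst
    have a3 := hkp s hs t ht hst
    obtain ⟨hs0, hsV, -⟩ := hrep s hs
    obtain ⟨ht0, htV, -⟩ := hrep t ht
    have hφd : |φ (t, γ t) - φ (s, γ s)| ≤ L * ((t - s) + ‖γ t - γ s‖) := by
      have := hL.dist_le_mul (t, γ t) (s, γ s)
      rw [Real.dist_eq, Prod.dist_eq] at this
      refine this.trans ?_
      gcongr
      refine max_le ?_ ?_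
      · show dist t s ≤ _
        rw [Real.dist_eq, abs_of_nonneg (by linarith)]
        linarith [norm_nonneg (γ t - γ s)]
      · show dist (γ t) (γ s) ≤ _
        rw [dist_eq_norm]; linarith
    have hγd : h s * ‖γ t - γ s‖ ≤ Q * ((∫ u in s..t, k3 u) + R * ∫ u in s..t, k2 u) := by
      have hsq : h s = Real.sqrt (h s) * Real.sqrt (h s) := (Real.mul_self_sqrt hs0).symm
      have e2 : Real.sqrt (h s) * ‖γ t - γ s‖ ≤
          ‖Real.sqrt (h t) • γ t - Real.sqrt (h s) • γ s‖
            + ‖Real.sqrt (h t) - Real.sqrt (h s)‖ * R := by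
        calc Real.sqrt (h s) * ‖γ t - γ s‖ = ‖Real.sqrt (h s) • (γ t - γ s)‖ := by
              rw [norm_smul, Real.norm_of_nonneg (Real.sqrt_nonneg _)]
          _ = ‖(Real.sqrt (h t) • γ t - Real.sqrt (h s) • γ s)
              - (Real.sqrt (h t) - Real.sqrt (h s)) • γ t‖ := by
              congr 1; rw [smul_sub, sub_smul]; abel
          _ ≤ _ := by
              refine (norm_sub_le _ _).trans ?_
              rw [norm_smul]
              gcongr
              exact hR _ htV
      have hR0 : 0 ≤ R := (norm_nonneg _).trans (hR _ htV)
      calc h s * ‖γ t - γ s‖ = Real.sqrt (h s) * (Real.sqrt (h s) * ‖γ t - γ s‖) := by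
            rw [← mul_assoc, ← hsq]
        _ ≤ Q * (‖Real.sqrt (h t) • γ t - Real.sqrt (h s) • γ s‖
            + ‖Real.sqrt (h t) - Real.sqrt (h s)‖ * R) := by
            gcongr
            exact (le_abs_self _).trans (hQ s hs)
        _ ≤ Q * ((∫ u in s..t, k3 u) + (∫ u in s..t, k2 u) * R) := by gcongr
        _ = _ := by ring
    have hsP : h s ≤ P := (le_abs_self _).trans (hP s hs)
    have e3 : F t - F s = (h t - h s) * φ (t, γ t) + h s * (φ (t, γ t) - φ (s, γ s)) := by
      simp only [hFdef]; ring
    calc |F t - F s| ≤ |h t - h s| * |φ (t, γ t)| + h s * |φ (t, γ t) - φ (s, γ s)| := by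
          rw [e3]
          refine (abs_add_le _ _).trans ?_
          rw [abs_mul, abs_mul, abs_of_nonneg hs0]
      _ ≤ (∫ u in s..t, k1 u) * M + h s * (L * ((t - s) + ‖γ t - γ s‖)) := by
          gcongr
          · exact (abs_nonneg _).trans a1
          · exact a1
          · exact hM _
      _ = (∫ u in s..t, k1 u) * M + (L * (h s * (t - s)) + L * (h s * ‖γ t - γ s‖)) := by ring
      _ ≤ (∫ u in s..t, k1 u) * M + (L * (P * (t - s)) +
            L * (Q * ((∫ u in s..t, k3 u) + R * ∫ u in s..t, k2 u))) := by
          have : 0 ≤ t - s := by linarith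
          gcongr
      _ = _ := by ring
  have hopen : IsOpen {t | t ∈ Ioo (0:ℝ) 1 ∧ 0 < h t} := by
    have := (hhcont.mono Ioo_subset_Icc_self).isOpen_inter_preimage isOpen_Ioo
      (isOpen_Ioi (a := (0:ℝ)))
    exact this
  rw [ae_restrict_iff' hopen.measurableSet] at hγder
  have hD : ∀ᵐ t ∂(volume.restrict (Ioo (0:ℝ) 1)), HasDerivAt F
      (∫ x, (fderiv ℝ φ (t, x) (1, v (t, x)) + φ (t, x) * g (t, x)) ∂(η.toFun t)) t := by
    filter_upwards [hder, ae_restrict_of_ae hγder, ae_restrict_mem measurableSet_Ioo]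
      with t hdt hγt htI
    obtain ⟨h0, -, he⟩ := hrep t (Ioo_subset_Icc_self htI)
    rw [he, integral_smul_measure, integral_dirac, smul_eq_mul, ENNReal.toReal_ofReal h0]
    rcases h0.eq_or_lt with hz | hpos
    · -- `h t = 0`
      rw [← hz, mul_zero] at hdt
      rw [← hz, zero_mul]
      rw [hasDerivAt_iff_isLittleO] at hdt ⊢
      simp only [← hz, sub_zero, smul_zero] at hdt ⊢
      have hFt : F t = 0 := by simp [hFdef, ← hz]
      simp only [hFt, sub_zero]
      refine Asymptotics.IsBigO.trans_isLittleO ?_ hdt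
      refine Asymptotics.IsBigO.of_bound M (Eventually.of_forall fun s => ?_)
      simp only [hFdef]
      rw [norm_mul, mul_comm]
      gcongr
      exact hM _
    · have hγ' := hγt ⟨htI, hpos⟩
      have hφd : HasFDerivAt φ (fderiv ℝ φ (t, γ t)) (t, γ t) :=
        (hsm.differentiable (by simp) _).hasFDerivAt
      have hcomp : HasDerivAt (fun s => φ (s, γ s)) (fderiv ℝ φ (t, γ t) (1, v (t, γ t))) t :=
        hφd.comp_hasDerivAt t ((hasDerivAt_id t).prodMk hγ')
      have := hdt.mul hcomp
      refine this.congr_deriv ?_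
      ring
  have hfin := ftc_ac hk hF hD (left_mem_Icc.2 zero_le_one) (right_mem_Icc.2 zero_le_one)
  rw [intervalIntegral.integral_of_le zero_le_one, integral_Ioc_eq_integral_Ioo] at hfin
  rw [hfin]
  have z : ∀ t : ℝ, t ∉ Ioo (0:ℝ) 1 → F t = 0 := by
    intro t ht
    have : φ (t, γ t) = 0 := image_eq_zero_of_notMem_tsupport fun hmem => ht (hts hmem).1
    simp [hFdef, this]
  rw [z 0 (by simp), z 1 (by simp), sub_zero]

lemma integral_bind_kernel {α β : Type*} [MeasurableSpace α] [MeasurableSpace β]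
    (μ : Measure α) (κ : ProbabilityTheory.Kernel α β) {f : β → ℝ}
    (hf : Integrable f (μ.bind κ)) :
    ∫ x, f x ∂(μ.bind κ) = ∫ a, ∫ x, f x ∂(κ a) ∂μ := by
  rw [Measure.comp_eq_comp_const_apply] at hf ⊢
  rw [ProbabilityTheory.Kernel.integral_comp hf]
  simp

/-- **Superposition principle (converse part).**
If `σ ∈ M⁺(𝒮_Ω)` is concentrated on `H_Ω^{v,g}` and satisfies
`∫₀¹ ∫ h(t) (1 + |v(t,γ(t))| + |g(t,γ(t))|) dσ dt < ∞`, then `σ ∈ M⁺₁(𝒮_Ω)` and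
`ρ_t^σ(E) = ∫ h(t) χ_E(γ(t)) dσ(γ,h)` defines a narrowly continuous curve of
positive measures solving `∂ₜ ρ + div (v ρ) = g ρ` on `X_Ω`. -/
theorem superposition_converse (d : ℕ) (hd : 1 ≤ d) (Ω : Set (Euc d))
    (hΩ : IsClosureOfBoundedDomain Ω)
    (v : XX d → Euc d) (g : XX d → ℝ) (hv : Measurable v) (hg : Measurable g)
    (σ : Measure (SCurve Ω)) (hσ : IsFiniteMeasure σ)
    (hconc : σ {η | ¬ MemHvg Ω v g η} = 0)
    (hbound : (∫⁻ t in Ioo (0:ℝ) 1, ∫⁻ η,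
        (∫⁻ x, ENNReal.ofReal (1 + ‖v (t, x)‖ + |g (t, x)|) ∂(η.toFun t)) ∂σ) < ⊤) :
    (∫⁻ η, supMass η ∂σ) < ⊤ ∧
    ∃ ρ : ℝ → Measure (Euc d),
      (∀ t ∈ Icc (0:ℝ) 1, ∀ s : Set (Euc d), MeasurableSet s →
        ρ t s = ∫⁻ η, η.toFun t s ∂σ) ∧
      NarrowCurve Ω ρ ∧ SolvesCE ρ v g := by
  obtain ⟨U, -, -, -, hUb, hΩU⟩ := hΩ
  have hΩb : Bornology.IsBounded Ω := by rw [hΩU]; exact hUb.closure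
  have hΩc : IsClosed Ω := by rw [hΩU]; exact isClosed_closure
  have hΩk : IsCompact Ω := Metric.isCompact_of_isClosed_isBounded hΩc hΩb
  have hae : ∀ᵐ η ∂σ, MemHvg Ω v g η := hconc
  set b : XX d → ℝ≥0∞ := fun p => ENNReal.ofReal (1 + ‖v p‖ + |g p|) with hb
  have hbm : Measurable b := by
    refine Measurable.ennreal_ofReal ?_
    have h1 : Measurable fun p => |g p| := by simpa using hg.norm
    exact (hv.norm.const_add 1).add h1
  have hGm : Measurable fun p : ℝ × SCurve Ω => ∫⁻ x, b (p.1, x) ∂(p.2.toFun p.1) :=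
    Measurable.lintegral_kernel_prod_right' (κ := kap Ω)
      (f := fun q : (ℝ × SCurve Ω) × Euc d => b (q.1.1, q.2)) (hbm.comp (by fun_prop))
  have hBm : Measurable (Bfun v g : SCurve Ω → ℝ≥0∞) :=
    Measurable.lintegral_prod_left' (μ := volume.restrict (Ioo (0:ℝ) 1)) hGm
  have hBfin : ∫⁻ η, Bfun v g η ∂σ < ⊤ := by
    have : ∫⁻ η, Bfun v g η ∂σ = ∫⁻ t in Ioo (0:ℝ) 1, ∫⁻ η,
        (∫⁻ x, ENNReal.ofReal (1 + ‖v (t, x)‖ + |g (t, x)|) ∂(η.toFun t)) ∂σ :=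
      (lintegral_lintegral_swap (μ := volume.restrict (Ioo (0:ℝ) 1)) (ν := σ)
        (f := fun t η => ∫⁻ x, b (t, x) ∂(η.toFun t)) hGm.aemeasurable).symm
    rw [this]; exact hbound
  have hsup : ∫⁻ η, supMass η ∂σ < ⊤ :=
    (lintegral_mono_ae (hae.mono fun η h => supMass_le h)).trans_lt hBfin
  refine ⟨hsup, ?_⟩
  let κ : ℝ → ProbabilityTheory.Kernel (SCurve Ω) (Euc d) := fun t =>
    (kap Ω).comap (fun η => (t, η)) measurable_prodMk_left
  have hκ : ∀ t η, κ t η = η.toFun t := fun t η => rfl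
  have hρ : ∀ t, ∀ s : Set (Euc d), MeasurableSet s →
      σ.bind (κ t) s = ∫⁻ η, η.toFun t s ∂σ := fun t s hs =>
    Measure.bind_apply hs (κ t).measurable.aemeasurable
  have hmass : ∀ t ∈ Icc (0:ℝ) 1, ∀ η : SCurve Ω, η.toFun t univ ≤ supMass η := fun t ht η =>
    le_iSup₂ (f := fun t (_ : t ∈ Icc (0:ℝ) 1) => η.toFun t univ) t ht
  have hnull : ∀ t, ∀ η : SCurve Ω, η.toFun t Ωᶜ = 0 := by
    intro t η
    obtain ⟨a, x, -, hx, he⟩ := η.cone t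
    rw [he]
    simp [hx, hΩc.measurableSet]
  have hρnull : ∀ t, σ.bind (κ t) Ωᶜ = 0 := by
    intro t
    rw [hρ t _ hΩc.measurableSet.compl]
    simp [hnull]
  have hρfin : ∀ t ∈ Icc (0:ℝ) 1, σ.bind (κ t) univ ≠ ⊤ := by
    intro t ht
    rw [hρ t _ MeasurableSet.univ]
    exact ((lintegral_mono fun η => hmass t ht η).trans_lt hsup).ne
  refine ⟨fun t => σ.bind (κ t), fun t _ => hρ t, ⟨fun t ht => ⟨hρnull t, hρfin t ht⟩, ?_⟩, ?_⟩
  · -- narrow continuity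
    intro φ hφ
    obtain ⟨C, hC⟩ := hΩk.exists_bound_of_continuousOn hφ.continuousOn
    have hC' : ∀ x ∈ Ω, ‖φ x‖ ≤ |C| := fun x hx => (hC x hx).trans (le_abs_self _)
    have heq : ∀ t ∈ Icc (0:ℝ) 1, ∫ x, φ x ∂(σ.bind (κ t)) = ∫ η, ∫ x, φ x ∂(η.toFun t) ∂σ := by
      intro t ht
      have : IsFiniteMeasure (σ.bind (κ t)) := ⟨(hρfin t ht).lt_top⟩
      have hint : Integrable φ (σ.bind (κ t)) := by
        refine Integrable.of_bound hφ.aestronglyMeasurable |C| ?_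
        have : ∀ᵐ x ∂(σ.bind (κ t)), x ∈ Ω := hρnull t
        exact this.mono hC'
      exact integral_bind_kernel σ _ hint
    refine ContinuousOn.congr ?_ heq
    refine continuousOn_of_dominated (bound := fun η => |C| * (Bfun v g η).toReal) ?_ ?_ ?_ ?_
    · intro t ht
      exact (StronglyMeasurable.integral_kernel (κ := κ t)
        hφ.stronglyMeasurable).aestronglyMeasurable
    · intro t ht
      filter_upwards [hae, ae_lt_top hBm hBfin.ne] with η h1 h2
      have h3 := (hmass t ht η).trans (supMass_le h1)
      have : ∀ᵐ x ∂(η.toFun t), ‖φ x‖ ≤ |C| := by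
        have : ∀ᵐ x ∂(η.toFun t), x ∈ Ω := hnull t η
        exact this.mono hC'
      refine (norm_integral_le_of_norm_le_const this).trans ?_
      gcongr
      exact ENNReal.toReal_mono h2.ne h3
    · exact (integrable_toReal_of_lintegral_ne_top hBm.aemeasurable hBfin.ne).const_mul _
    · exact Eventually.of_forall fun η => (η.narrow φ hφ).continuousOn
  · -- continuity equation
    intro φ hφ
    obtain ⟨hsm, hcs, hts⟩ := id hφ
    obtain ⟨L, hL⟩ := hsm.lipschitzWith_of_hasCompactSupport hcs (by simp)
    obtain ⟨M, hM⟩ := hsm.continuous.bounded_above_of_compact_support hcs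
    have hM0 : 0 ≤ M := (norm_nonneg _).trans (hM 0)
    set f : XX d → ℝ := fun p => fderiv ℝ φ p (1, v p) + φ p * g p with hf
    have hfm : Measurable f := by
      refine Measurable.add ?_ (hsm.continuous.measurable.mul hg)
      exact (hsm.continuous_fderiv_apply (by simp)).measurable.comp
        (measurable_id.prodMk (measurable_const.prodMk hv))
    have hfb : ∀ p, ‖f p‖ₑ ≤ ENNReal.ofReal (L + M) * b p := by
      intro p
      rw [hb, ← ENNReal.ofReal_mul (by positivity), Real.enorm_eq_ofReal_abs]
      apply ENNReal.ofReal_le_ofReal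
      have h1 : |fderiv ℝ φ p (1, v p)| ≤ L * (1 + ‖v p‖) := by
        refine ((fderiv ℝ φ p).le_opNorm _).trans ?_
        gcongr
        · exact norm_fderiv_le_of_lipschitz ℝ hL
        · rw [Prod.norm_def]
          refine max_le ?_ ?_
          · simp
          · show ‖v p‖ ≤ _
            linarith
      have h2 : |φ p * g p| ≤ M * |g p| := by
        rw [abs_mul]; gcongr; exact hM p
      have h3 := abs_add_le (fderiv ℝ φ p (1, v p)) (φ p * g p)
      have h4 : 0 ≤ (L:ℝ) * |g p| := by positivity
      have h5 : 0 ≤ M * (1 + ‖v p‖) := by positivity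
      simp only [hf]
      nlinarith
    have hfb2 : ∀ t (η : SCurve Ω), ∫⁻ x, ‖f (t, x)‖ₑ ∂(η.toFun t) ≤
        ENNReal.ofReal (L + M) * ∫⁻ x, b (t, x) ∂(η.toFun t) := by
      intro t η
      have hbt : Measurable fun x => b (t, x) := hbm.comp (by fun_prop)
      rw [← lintegral_const_mul _ hbt]
      exact lintegral_mono fun x => hfb (t, x)
    have hΦm : StronglyMeasurable fun p : ℝ × SCurve Ω => ∫ x, f (p.1, x) ∂(p.2.toFun p.1) :=
      StronglyMeasurable.integral_kernel_prod_right' (κ := kap Ω)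
        (f := fun q : (ℝ × SCurve Ω) × Euc d => f (q.1.1, q.2))
        (hfm.comp (by fun_prop)).stronglyMeasurable
    have hΦi : Integrable (Function.uncurry fun (t : ℝ) (η : SCurve Ω) =>
        ∫ x, f (t, x) ∂(η.toFun t)) ((volume.restrict (Ioo (0:ℝ) 1)).prod σ) := by
      refine ⟨hΦm.aestronglyMeasurable, ?_⟩
      have h1 : ∫⁻ p : ℝ × SCurve Ω, ∫⁻ x, b (p.1, x) ∂(p.2.toFun p.1)
          ∂((volume.restrict (Ioo (0:ℝ) 1)).prod σ) < ⊤ := by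
        rw [lintegral_prod _ hGm.aemeasurable]; exact hbound
      refine lt_of_le_of_lt (b := ENNReal.ofReal (L + M) *
        ∫⁻ p : ℝ × SCurve Ω, ∫⁻ x, b (p.1, x) ∂(p.2.toFun p.1)
          ∂((volume.restrict (Ioo (0:ℝ) 1)).prod σ)) ?_
        (ENNReal.mul_lt_top ENNReal.ofReal_lt_top h1)
      rw [← lintegral_const_mul _ hGm]
      exact lintegral_mono fun p =>
        (enorm_integral_le_lintegral_enorm _).trans (hfb2 p.1 p.2)
    have hstep : ∀ᵐ t ∂(volume.restrict (Ioo (0:ℝ) 1)),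
        ∫ x, f (t, x) ∂(σ.bind (κ t)) = ∫ η, ∫ x, f (t, x) ∂(η.toFun t) ∂σ := by
      have hm : Measurable fun t : ℝ => ∫⁻ η : SCurve Ω, ∫⁻ x, b (t, x) ∂(η.toFun t) ∂σ :=
        Measurable.lintegral_prod_right' (ν := σ) hGm
      filter_upwards [ae_lt_top hm hbound.ne] with t ht
      have hft : Measurable fun x => f (t, x) := hfm.comp (by fun_prop)
      have hint : Integrable (fun x => f (t, x)) (σ.bind (κ t)) := by
        refine ⟨hft.aestronglyMeasurable, ?_⟩
        show ∫⁻ x, ‖f (t, x)‖ₑ ∂(σ.bind (κ t)) < ⊤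
        rw [Measure.lintegral_bind (κ t).measurable.aemeasurable hft.enorm.aemeasurable]
        refine lt_of_le_of_lt (lintegral_mono fun η => hfb2 t η) ?_
        have hGt : Measurable fun η : SCurve Ω => ∫⁻ x, b (t, x) ∂(η.toFun t) :=
          hGm.comp measurable_prodMk_left
        rw [lintegral_const_mul _ hGt]
        exact ENNReal.mul_lt_top ENNReal.ofReal_lt_top ht
      exact integral_bind_kernel σ _ hint
    show ∫ t in Ioo (0:ℝ) 1, ∫ x, f (t, x) ∂(σ.bind (κ t)) = 0
    rw [integral_congr_ae hstep, integral_integral_swap hΦi]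
    exact integral_eq_zero_of_ae (hae.mono fun η h => curve_solves hΩb h hφ)

end Paper
end
end

section
/- Properties of measure solutions of the continuity equation: Let Ω ⊂ ℝ^d be the closure of a bounded domain and assume (ρ,m,μ) ∈ M_Ω is a measure solution of ∂_t ρ + div m = μ with ρ ∈ M⁺(X_Ω). Then ρ disintegrates as ρ = dt ⊗ ρ_t with ρ_t ∈ M⁺(Ω) for a.e. t ∈ (0,1); the map t ↦ ρ_t(Ω) belongs to BV(0,1) with distributional derivative π_#μ, where π : X_Ω → (0,1) is the projection onto the time coordinate. If in addition m = vρ and μ = gρ for measurable v : X_Ω → ℝ^d, g : X_Ω → ℝ with ∫₀¹∫_Ω (|v(t,x)| + |g(t,x)|) dρ_t(x) dt < ∞, then there exists a narrowly continuous curve t ↦ ρ̃_t in C_w([0,1];M⁺(Ω)) such that ρ_t = ρ̃_t for a.e. t ∈ (0,1). -/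
open MeasureTheory Set Filter Topology
open scoped ENNReal NNReal

noncomputable section

namespace Paper

variable {d : ℕ}

/-- a fixed bump on (0,1) with integral one -/
lemma exists_psi0 : ∃ ψ : ℝ → ℝ, ContDiff ℝ (⊤ : ℕ∞) ψ ∧ HasCompactSupport ψ ∧
    tsupport ψ ⊆ Ioo (0:ℝ) 1 ∧ (∀ x, 0 ≤ ψ x) ∧ ∫ x, ψ x = 1 := by
  let b : ContDiffBump (1/2 : ℝ) := ⟨1/8, 1/4, by norm_num, by norm_num⟩
  refine ⟨b.normed volume, b.contDiff_normed, b.hasCompactSupport_normed, ?_, fun x => b.nonneg_normed x, b.integral_normed⟩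
  rw [b.tsupport_normed_eq, Real.closedBall_eq_Icc]
  intro x hx
  simp only [b, mem_Icc] at hx
  constructor <;> linarith [hx.1, hx.2]

/-- primitive of a test function with zero mean is a test function -/
lemma exists_primitive (ψ : ℝ → ℝ) (h1 : ContDiff ℝ (⊤ : ℕ∞) ψ) (h2 : HasCompactSupport ψ)
    (h3 : tsupport ψ ⊆ Ioo (0:ℝ) 1) (h4 : ∫ x, ψ x = 0) :
    ∃ φ : ℝ → ℝ, ContDiff ℝ (⊤ : ℕ∞) φ ∧ HasCompactSupport φ ∧ tsupport φ ⊆ Ioo (0:ℝ) 1 ∧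
      deriv φ = ψ ∧ ∀ x, |φ x| ≤ ∫ y, |ψ y| := by
  obtain ⟨a, b, ha, hab, hb, hs⟩ : ∃ a b : ℝ, 0 < a ∧ a ≤ b ∧ b < 1 ∧ tsupport ψ ⊆ Icc a b := by
    rcases (tsupport ψ).eq_empty_or_nonempty with h | h
    · exact ⟨1/2, 1/2, by norm_num, le_rfl, by norm_num, by simp [h]⟩
    · obtain ⟨a, ha, ha'⟩ := h2.isCompact.exists_isLeast h
      obtain ⟨b, hb, hb'⟩ := h2.isCompact.exists_isGreatest h
      exact ⟨a, b, (h3 ha).1, ha' hb, (h3 hb).2, fun x hx => ⟨ha' hx, hb' hx⟩⟩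
  have hz : ∀ x, x ∉ Icc a b → ψ x = 0 := fun x hx => image_eq_zero_of_notMem_tsupport (fun h => hx (hs h))
  have hint : Integrable ψ := h1.continuous.integrable_of_hasCompactSupport h2
  have hd : ∀ x, HasDerivAt (fun t => ∫ y in (0:ℝ)..t, ψ y) (ψ x) x := fun x =>
    intervalIntegral.integral_hasDerivAt_right (h1.continuous.intervalIntegrable _ _)
      h1.continuous.stronglyMeasurable.stronglyMeasurableAtFilter h1.continuous.continuousAt
  have hder : deriv (fun t => ∫ y in (0:ℝ)..t, ψ y) = ψ := funext fun x => (hd x).deriv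
  have hsupp : Function.support (fun t => ∫ y in (0:ℝ)..t, ψ y) ⊆ Icc a b := by
    intro t ht
    by_contra hc
    apply ht
    simp only
    rcases lt_or_ge t a with h | h
    · rw [intervalIntegral.integral_congr (g := fun _ => 0)]
      · simp
      · intro y hy
        apply hz
        intro hy'
        rcases (mem_uIcc.1 hy) with h'|h'
        · linarith [h'.2, hy'.1]
        · linarith [h'.2, hy'.1]
    · have htb : b < t := by
        by_contra h'
        exact hc ⟨h, not_lt.1 h'⟩
      rw [intervalIntegral.integral_of_le (by linarith), setIntegral_eq_integral_of_forall_compl_eq_zero, h4]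
      intro x hx
      apply hz
      intro hx'
      exact hx ⟨by linarith [hx'.1], by linarith [hx'.2]⟩
  have hts : tsupport (fun t => ∫ y in (0:ℝ)..t, ψ y) ⊆ Icc a b := closure_minimal hsupp isClosed_Icc
  refine ⟨fun t => ∫ y in (0:ℝ)..t, ψ y, ?_, ?_, ?_, hder, ?_⟩
  · rw [contDiff_infty_iff_deriv, hder]
    exact ⟨fun x => (hd x).differentiableAt, h1⟩
  · exact isCompact_Icc.of_isClosed_subset (isClosed_tsupport _) hts
  · exact hts.trans (fun x hx => ⟨by linarith [hx.1], by linarith [hx.2]⟩)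
  · intro x
    refine (intervalIntegral.norm_integral_le_integral_norm_uIoc (f := ψ)).trans ?_
    exact setIntegral_le_integral hint.norm (Eventually.of_forall fun y => norm_nonneg _)

lemma weak_deriv_ae_eq (f h : ℝ → ℝ) (hf : IntegrableOn f (Ioo 0 1)) (hh : IntegrableOn h (Ioo 0 1))
    (H : ∀ φ : ℝ → ℝ, ContDiff ℝ (⊤ : ℕ∞) φ → HasCompactSupport φ → tsupport φ ⊆ Ioo (0:ℝ) 1 →
      ∫ t in Ioo (0:ℝ) 1, deriv φ t * f t = - ∫ t in Ioo (0:ℝ) 1, φ t * h t) :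
    ∃ F : ℝ → ℝ, ContinuousOn F (Icc 0 1) ∧ ∀ᵐ t ∂(volume.restrict (Ioo (0:ℝ) 1)), f t = F t := by
  have hi : IntervalIntegrable h volume 0 1 := by
    rw [intervalIntegrable_iff_integrableOn_Ioo_of_le zero_le_one]; exact hh
  set G : ℝ → ℝ := fun x => ∫ v in (0:ℝ)..x, h v with hG
  have hGac : AbsolutelyContinuousOnInterval G 0 1 :=
    hi.absolutelyContinuousOnInterval_intervalIntegral (by simp)
  have hGc : ContinuousOn G (Icc 0 1) := by
    have := hGac.continuousOn; rwa [uIcc_of_le zero_le_one] at this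
  have hGd : ∀ᵐ x, x ∈ Ioo (0:ℝ) 1 → deriv G x = h x := by
    filter_upwards [hi.ae_hasDerivAt_integral] with x hx hx'
    exact (hx (by rw [uIcc_of_le zero_le_one]; exact Ioo_subset_Icc_self hx') 0 (by simp)).deriv
  have hGint : IntegrableOn G (Ioo 0 1) :=
    (hGc.integrableOn_Icc).mono_set Ioo_subset_Icc_self
  have hbd : ∀ u : ℝ → ℝ, Continuous u → ∀ k : ℝ → ℝ, IntegrableOn k (Ioo 0 1) →
      IntegrableOn (fun t => u t * k t) (Ioo 0 1) := by
    intro u hu k hk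
    obtain ⟨C, hC⟩ := isCompact_Icc.exists_bound_of_continuousOn (s := Icc (0:ℝ) 1) hu.continuousOn
    refine hk.bdd_mul (c := C) hu.aestronglyMeasurable ?_
    exact (ae_restrict_iff' measurableSet_Ioo).2 (Eventually.of_forall fun t ht => hC t (Ioo_subset_Icc_self ht))
  have key : ∀ φ : ℝ → ℝ, ContDiff ℝ (⊤ : ℕ∞) φ → HasCompactSupport φ → tsupport φ ⊆ Ioo (0:ℝ) 1 →
      ∫ t in Ioo (0:ℝ) 1, deriv φ t * (f t - G t) = 0 := by
    intro φ h1 h2 h3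
    have hφac : AbsolutelyContinuousOnInterval φ 0 1 :=
      (h1.of_le (by exact_mod_cast le_top) : ContDiff ℝ 1 φ).contDiffOn.absolutelyContinuousOnInterval
    have e := hφac.integral_mul_deriv_eq_deriv_mul hGac
    have hφ0 : φ 0 = 0 := image_eq_zero_of_notMem_tsupport (fun h => by simpa using h3 h)
    have hφ1 : φ 1 = 0 := image_eq_zero_of_notMem_tsupport (fun h => by simpa using h3 h)
    rw [hφ0, hφ1, intervalIntegral.integral_of_le zero_le_one, intervalIntegral.integral_of_le zero_le_one,
      integral_Ioc_eq_integral_Ioo, integral_Ioc_eq_integral_Ioo] at e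
    have e2 : ∫ t in Ioo (0:ℝ) 1, φ t * deriv G t = ∫ t in Ioo (0:ℝ) 1, φ t * h t := by
      apply setIntegral_congr_ae measurableSet_Ioo
      filter_upwards [hGd] with x hx hx'
      rw [hx hx']
    have hdc : Continuous (deriv φ) := h1.continuous_deriv (by simp)
    simp_rw [mul_sub]
    rw [integral_sub (hbd _ hdc _ hf) (hbd _ hdc _ hGint), H φ h1 h2 h3]
    linarith
  obtain ⟨ψ0, p1, p2, p3, p4, p5⟩ := exists_psi0
  set c := ∫ t in Ioo (0:ℝ) 1, ψ0 t * (f t - G t) with hc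
  have hk : IntegrableOn (fun t => f t - G t) (Ioo 0 1) := hf.sub hGint
  refine ⟨fun t => G t + c, hGc.add continuousOn_const, ?_⟩
  have hk2 : IntegrableOn (fun t => f t - G t - c) (Ioo 0 1) := hk.sub (integrableOn_const (by simp))
  have := isOpen_Ioo.ae_eq_zero_of_integral_contDiff_smul_eq_zero (μ := volume) (U := Ioo (0:ℝ) 1)
    (f := fun t => f t - G t - c) hk2.locallyIntegrableOn ?_
  · rw [ae_restrict_iff' measurableSet_Ioo]
    filter_upwards [this] with t ht ht'
    linarith [ht ht']
  · intro ψ h1 h2 h3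
    have hsub : ∀ u : ℝ → ℝ, ∀ k : ℝ → ℝ, tsupport u ⊆ Ioo 0 1 →
        ∫ t in Ioo (0:ℝ) 1, u t * k t = ∫ t, u t * k t := by
      intro u k hu
      apply setIntegral_eq_integral_of_forall_compl_eq_zero
      intro x hx
      rw [image_eq_zero_of_notMem_tsupport (fun h => hx (hu h)), zero_mul]
    have hψi : Integrable ψ := h1.continuous.integrable_of_hasCompactSupport h2
    have hψ0i : Integrable ψ0 := p1.continuous.integrable_of_hasCompactSupport p2
    set I := ∫ t, ψ t with hI
    have hts : tsupport (fun t => ψ t - I * ψ0 t) ⊆ Ioo 0 1 := by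
      refine (tsupport_sub ψ (fun t => I * ψ0 t)).trans (union_subset h3 ?_)
      exact (closure_mono (Function.support_mul_subset_right _ _)).trans p3
    have hcs : HasCompactSupport (fun t => ψ t - I * ψ0 t) := h2.sub (p2.mul_left (f := fun _ => I))
    obtain ⟨φ, f1, f2, f3, f4, f5⟩ := exists_primitive (fun t => ψ t - I * ψ0 t)
      (h1.sub (contDiff_const.mul p1)) hcs hts (by
        rw [integral_sub hψi (hψ0i.const_mul _), integral_const_mul, p5, mul_one, sub_self])
    have e := key φ f1 f2 f3
    rw [f4] at e
    simp only [smul_eq_mul]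
    rw [← hsub _ _ h3]
    have q1 := hbd ψ h1.continuous _ hk
    have q2 := hbd ψ0 p1.continuous _ hk
    have e3 : ∫ t in Ioo (0:ℝ) 1, (ψ t - I * ψ0 t) * (f t - G t) =
        (∫ t in Ioo (0:ℝ) 1, ψ t * (f t - G t)) - I * c := by
      rw [hc, ← integral_const_mul, ← integral_sub q1 (q2.const_mul _)]
      congr 1; ext t; ring
    have e4 : ∫ t in Ioo (0:ℝ) 1, ψ t * (f t - G t - c) =
        (∫ t in Ioo (0:ℝ) 1, ψ t * (f t - G t)) - I * c := by
      have : I = ∫ t in Ioo (0:ℝ) 1, ψ t := by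
        have := hsub ψ (fun _ => 1) h3
        simp only [mul_one] at this
        rw [this]
      rw [this, ← integral_mul_const, ← integral_sub q1 (hψi.integrableOn.mul_const _)]
      congr 1; ext t; ring
    rw [e4, ← e3, e]


lemma narrow_extension {K : Type*} [MetricSpace K] [CompactSpace K] [MeasurableSpace K] [BorelSpace K]
    (lam : ℝ → Measure K) (T : Set ℝ) (hT : Icc (0:ℝ) 1 ⊆ closure T) (hT' : T ⊆ Icc 0 1)
    (hfin : ∀ t ∈ T, IsFiniteMeasure (lam t)) (M : ℝ) (hM : ∀ t ∈ T, (lam t).real univ ≤ M)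
    (D : Set C(K, ℝ)) (hD : Dense D)
    (hF : ∀ ζ ∈ D, ∃ F : ℝ → ℝ, ContinuousOn F (Icc 0 1) ∧ ∀ t ∈ T, ∫ x, ζ x ∂(lam t) = F t) :
    ∃ ρ : ℝ → Measure K, (∀ t ∈ Icc (0:ℝ) 1, IsFiniteMeasure (ρ t)) ∧
      (∀ φ : C(K, ℝ), ContinuousOn (fun t => ∫ x, φ x ∂(ρ t)) (Icc 0 1)) ∧
      ∀ t ∈ T, lam t = ρ t := by
  have hint : ∀ φ : C(K, ℝ), ∀ t ∈ T, Integrable φ (lam t) := by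
    intro φ t ht
    have := hfin t ht
    exact Integrable.of_bound φ.continuous.aestronglyMeasurable ‖φ‖ (Eventually.of_forall φ.norm_coe_le_norm)
  have hM0 : ∀ t ∈ T, 0 ≤ M := fun t ht => measureReal_nonneg.trans (hM t ht)
  have hdist : ∀ φ ζ : C(K, ℝ), ∀ t ∈ T, |∫ x, φ x ∂(lam t) - ∫ x, ζ x ∂(lam t)| ≤ ‖φ - ζ‖ * M := by
    intro φ ζ t ht
    have := hfin t ht
    rw [← integral_sub (hint φ t ht) (hint ζ t ht)]
    refine (norm_integral_le_of_norm_le_const (μ := lam t) (f := fun x => φ x - ζ x) (C := ‖φ - ζ‖) (Eventually.of_forall fun x => ?_)).trans ?_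
    · exact (φ - ζ).norm_coe_le_norm x
    · exact mul_le_mul_of_nonneg_left (hM t ht) (norm_nonneg _)
  have hlim : ∀ φ : C(K, ℝ), ∀ t ∈ Icc (0:ℝ) 1, ∃ y, Tendsto (fun s => ∫ x, φ x ∂(lam s)) (𝓝[T] t) (𝓝 y) := by
    intro φ t ht
    have hne : (𝓝[T] t).NeBot := mem_closure_iff_nhdsWithin_neBot.1 (hT ht)
    rw [← cauchy_map_iff_exists_tendsto, Metric.cauchy_iff]
    refine ⟨inferInstance, fun ε hε => ?_⟩
    obtain ⟨ζ, hζD, hζ⟩ : ∃ ζ ∈ D, dist φ ζ < ε / (3 * (|M| + 1)) :=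
      hD.exists_dist_lt φ (by positivity)
    obtain ⟨F, hFc, hFe⟩ := hF ζ hζD
    have hb : ∀ s ∈ T, |∫ x, φ x ∂(lam s) - F s| < ε / 3 := by
      intro s hs
      rw [← hFe s hs]
      refine (hdist φ ζ s hs).trans_lt ?_
      rw [dist_eq_norm] at hζ
      have h0 := hM0 s hs
      rw [abs_of_nonneg h0] at hζ
      rw [lt_div_iff₀ (by positivity)] at hζ
      nlinarith [norm_nonneg (φ - ζ)]
    have hc : Tendsto F (𝓝[T] t) (𝓝 (F t)) := (hFc t ht).mono_left (nhdsWithin_mono _ hT')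
    have hc' : {s | |F s - F t| < ε / 6} ∈ 𝓝[T] t := by
      have := hc.eventually (Metric.ball_mem_nhds (F t) (show 0 < ε/6 by positivity))
      exact this
    refine ⟨_, image_mem_map (inter_mem hc' self_mem_nhdsWithin), ?_⟩
    rintro _ ⟨s, ⟨hs1, hs2⟩, rfl⟩ _ ⟨r, ⟨hr1, hr2⟩, rfl⟩
    have a1 := abs_lt.1 (hb s hs2)
    have a2 := abs_lt.1 (hb r hr2)
    have a3 := abs_lt.1 (show |F s - F t| < ε / 6 from hs1)
    have a4 := abs_lt.1 (show |F r - F t| < ε / 6 from hr1)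
    rw [Real.dist_eq, abs_lt]
    constructor <;> linarith [a1.1, a1.2, a2.1, a2.2, a3.1, a3.2, a4.1, a4.2]
  let L : C(K, ℝ) → ℝ → ℝ := fun φ => extendFrom T (fun s => ∫ x, φ x ∂(lam s))
  have hL : ∀ φ, ∀ t ∈ Icc (0:ℝ) 1, Tendsto (fun s => ∫ x, φ x ∂(lam s)) (𝓝[T] t) (𝓝 (L φ t)) :=
    fun φ t ht => tendsto_extendFrom (hlim φ t ht)
  have hLc : ∀ φ, ContinuousOn (L φ) (Icc 0 1) := fun φ => continuousOn_extendFrom hT (hlim φ)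
  have hLT : ∀ φ, ∀ t ∈ T, L φ t = ∫ x, φ x ∂(lam t) := by
    intro φ t ht
    have h1 := hL φ t (hT' ht)
    have h2 := h1.mono_left (pure_le_nhdsWithin ht)
    exact (tendsto_pure_nhds (fun s => ∫ x, φ x ∂(lam s)) t |> tendsto_nhds_unique h2)
  have hex : ∀ t ∈ Icc (0:ℝ) 1, ∃ ρ : Measure K, IsFiniteMeasure ρ ∧ ∀ φ : C(K, ℝ), ∫ x, φ x ∂ρ = L φ t := by
    intro t ht
    have hne : (𝓝[T] t).NeBot := mem_closure_iff_nhdsWithin_neBot.1 (hT ht)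
    let Λ : CompactlySupportedContinuousMap K ℝ →ₚ[ℝ] ℝ :=
    { toFun := fun g => L g.toContinuousMap t
      map_add' := fun g g' => by
        refine tendsto_nhds_unique (hL _ t ht) (((hL g.toContinuousMap t ht).add (hL g'.toContinuousMap t ht)).congr' ?_)
        filter_upwards [self_mem_nhdsWithin] with s hs
        exact (integral_add (hint g.toContinuousMap s hs) (hint g'.toContinuousMap s hs)).symm
      map_smul' := fun c g => by
        refine tendsto_nhds_unique (hL _ t ht) (((hL g.toContinuousMap t ht).const_mul c).congr' ?_)
        filter_upwards [self_mem_nhdsWithin] with s hs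
        exact (integral_const_mul c _).symm
      monotone' := fun g g' hgg' => by
        refine le_of_tendsto_of_tendsto (hL g.toContinuousMap t ht) (hL g'.toContinuousMap t ht) ?_
        filter_upwards [self_mem_nhdsWithin] with s hs
        exact integral_mono (hint g.toContinuousMap s hs) (hint g'.toContinuousMap s hs) hgg' }
    refine ⟨RealRMK.rieszMeasure Λ, inferInstance, fun φ => ?_⟩
    exact RealRMK.integral_rieszMeasure Λ ⟨φ, HasCompactSupport.of_compactSpace _⟩
  choose! ρ hρ1 hρ2 using hex
  refine ⟨ρ, hρ1, fun φ => (hLc φ).congr fun t ht => hρ2 t ht φ, fun t ht => ?_⟩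
  have := hfin t ht
  have := hρ1 t (hT' ht)
  refine ext_of_forall_integral_eq_of_IsFiniteMeasure fun f => ?_
  exact ((hρ2 t (hT' ht) f.toContinuousMap).trans (hLT f.toContinuousMap t ht)).symm

/-- countable family of smooth compactly supported functions dense on a compact set -/
lemma exists_countable_smooth_dense {E : Type*} [NormedAddCommGroup E] [InnerProductSpace ℝ E]
    [FiniteDimensional ℝ E] (Ω : Set E) (hΩ : IsCompact Ω) :
    ∃ D : Set (E → ℝ), D.Countable ∧ (∀ ζ ∈ D, ContDiff ℝ (⊤ : ℕ∞) ζ ∧ HasCompactSupport ζ) ∧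
      (∃ ζ ∈ D, ∀ x ∈ Ω, ζ x = 1) ∧
      Dense {f : C(Ω, ℝ) | ∃ ζ ∈ D, ∀ x : Ω, f x = ζ x} := by
  have : CompactSpace Ω := isCompact_iff_compactSpace.1 hΩ
  obtain ⟨R, hR0, hR⟩ : ∃ R : ℝ, 0 < R ∧ Ω ⊆ Metric.closedBall 0 R := by
    obtain ⟨R, hR⟩ := hΩ.isBounded.subset_closedBall (0:E)
    exact ⟨max R 1, by positivity, hR.trans (Metric.closedBall_subset_closedBall (le_max_left _ _))⟩
  let χ : ContDiffBump (0:E) := ⟨R, R+1, hR0, by linarith⟩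
  have hχ : ∀ x ∈ Ω, χ x = 1 := fun x hx => χ.one_of_mem_closedBall (hR hx)
  let A : Subalgebra ℝ C(Ω, ℝ) :=
  { carrier := {f | ∃ ζ : E → ℝ, ContDiff ℝ (⊤ : ℕ∞) ζ ∧ ∀ x : Ω, f x = ζ x}
    mul_mem' := by
      rintro f g ⟨a, ha, ha'⟩ ⟨b, hb, hb'⟩
      exact ⟨fun x => a x * b x, ha.mul hb, fun x => by simp [ha', hb']⟩
    add_mem' := by
      rintro f g ⟨a, ha, ha'⟩ ⟨b, hb, hb'⟩
      exact ⟨fun x => a x + b x, ha.add hb, fun x => by simp [ha', hb']⟩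
    algebraMap_mem' := fun r => ⟨fun _ => r, contDiff_const, fun x => by simp⟩ }
  have hA : A.SeparatesPoints := by
    intro x y hxy
    refine ⟨fun z : Ω => inner ℝ ((x:E) - y) (z:E), ⟨⟨fun z : Ω => inner ℝ ((x:E) - y) (z:E), by fun_prop⟩, ?_, rfl⟩, ?_⟩
    · exact ⟨fun z => inner ℝ ((x:E) - y) z, contDiff_const.inner ℝ contDiff_id, fun x => rfl⟩
    · simp only
      intro h
      have : inner ℝ ((x:E) - y) ((x:E) - y) = 0 := by rw [inner_sub_right]; linarith
      rw [inner_self_eq_zero, sub_eq_zero] at this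
      exact hxy (Subtype.ext this)
  have hAd := ContinuousMap.subalgebra_topologicalClosure_eq_top_of_separatesPoints A hA
  have hAd' : Dense (A : Set C(Ω, ℝ)) := by
    intro f
    have : f ∈ A.topologicalClosure := by rw [hAd]; trivial
    exact this
  obtain ⟨S, hSA, hSc, hSd⟩ := Dense.exists_countable_dense_subset hAd'
  choose! e he1 he2 using (show ∀ f ∈ S, ∃ ζ : E → ℝ, ContDiff ℝ (⊤ : ℕ∞) ζ ∧ ∀ x : Ω, f x = ζ x from
    fun f hf => hSA hf)
  refine ⟨insert (fun x => χ x) ((fun f x => χ x * e f x) '' S), (hSc.image _).insert _, ?_,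
    ⟨_, mem_insert _ _, hχ⟩, hSd.mono ?_⟩
  · rintro ζ (rfl | ⟨f, hf, rfl⟩)
    · exact ⟨χ.contDiff, χ.hasCompactSupport⟩
    · exact ⟨χ.contDiff.mul (he1 f hf), χ.hasCompactSupport.mul_right⟩
  · intro f hf
    exact ⟨_, mem_insert_of_mem _ ⟨f, hf, rfl⟩, fun x => by simp [hχ x x.2, he2 f hf x]⟩


lemma signed_density {α : Type*} [MeasurableSpace α] (σ : SignedMeasure α) (lam : Measure α)
    [IsFiniteMeasure lam] (hp : σ.toJordanDecomposition.posPart ≪ lam)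
    (hn : σ.toJordanDecomposition.negPart ≪ lam) :
    ∃ u : α → ℝ, Measurable u ∧ Integrable u lam ∧
      (∀ s, MeasurableSet s → σ s = ∫ x in s, u x ∂lam) ∧
      (∀ ψ : α → ℝ, Measurable ψ → (∃ C, ∀ x, |ψ x| ≤ C) → sInt σ ψ = ∫ x, ψ x * u x ∂lam) := by
  set p := σ.toJordanDecomposition.posPart with hpdef
  set n := σ.toJordanDecomposition.negPart with hndef
  have ip : Integrable (fun x => (p.rnDeriv lam x).toReal) lam := Measure.integrable_toReal_rnDeriv
  have iN : Integrable (fun x => (n.rnDeriv lam x).toReal) lam := Measure.integrable_toReal_rnDeriv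
  refine ⟨fun x => (p.rnDeriv lam x).toReal - (n.rnDeriv lam x).toReal,
    (Measure.measurable_rnDeriv _ _).ennreal_toReal.sub (Measure.measurable_rnDeriv _ _).ennreal_toReal,
    ip.sub iN, ?_, ?_⟩
  · intro s hs
    rw [integral_sub ip.integrableOn iN.integrableOn, Measure.setIntegral_toReal_rnDeriv hp s,
      Measure.setIntegral_toReal_rnDeriv hn s]
    conv_lhs => rw [← σ.toSignedMeasure_toJordanDecomposition]
    simp [JordanDecomposition.toSignedMeasure, hs, hpdef, hndef]
  · rintro ψ hψ ⟨C, hC⟩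
    have b : ∀ k : α → ℝ, Integrable k lam → Integrable (fun x => ψ x * k x) lam := fun k hk =>
      hk.bdd_mul (c := C) hψ.aestronglyMeasurable (Eventually.of_forall hC)
    simp_rw [mul_sub]
    rw [integral_sub (b _ ip) (b _ iN), sInt, ← integral_rnDeriv_smul hp, ← integral_rnDeriv_smul hn]
    simp [mul_comm]
    

lemma exists_densities {d : ℕ} (m : VectorMeasure (XX d) (Euc d)) (μ : SignedMeasure (XX d)) :
    ∃ (lam : Measure (XX d)) (w : XX d → Euc d) (u : XX d → ℝ), IsFiniteMeasure lam ∧ Measurable w ∧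
      Measurable u ∧ Integrable w lam ∧ Integrable u lam ∧ IsDensityV m lam w ∧ IsDensityS μ lam u ∧
      (∀ ψ : XX d → ℝ, Measurable ψ → (∃ C, ∀ x, |ψ x| ≤ C) → sInt μ ψ = ∫ x, ψ x * u x ∂lam) := by
  let mi : Fin d → SignedMeasure (XX d) := fun i =>
    m.mapRange (EuclideanSpace.proj (𝕜 := ℝ) i).toLinearMap.toAddMonoidHom
      (EuclideanSpace.proj (𝕜 := ℝ) i).continuous
  let tv : SignedMeasure (XX d) → Measure (XX d) := fun σ =>
    σ.toJordanDecomposition.posPart + σ.toJordanDecomposition.negPart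
  have htv : ∀ σ, IsFiniteMeasure (tv σ) := fun σ => by simp only [tv]; infer_instance
  let lam : Measure (XX d) := tv μ + ∑ i, tv (mi i)
  have hlam : IsFiniteMeasure lam := by
    simp only [lam]; infer_instance
  have h1 : tv μ ≤ lam := Measure.le_add_right le_rfl
  have h2 : ∀ i, tv (mi i) ≤ lam := fun i => by
    refine le_trans ?_ (Measure.le_add_left le_rfl)
    exact Finset.single_le_sum (f := fun i => tv (mi i)) (fun j _ => Measure.zero_le _) (Finset.mem_univ i)
  have hp : ∀ σ, tv σ ≤ lam → σ.toJordanDecomposition.posPart ≪ lam := fun σ h =>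
    Measure.absolutelyContinuous_of_le ((Measure.le_add_right le_rfl).trans h)
  have hn : ∀ σ, tv σ ≤ lam → σ.toJordanDecomposition.negPart ≪ lam := fun σ h =>
    Measure.absolutelyContinuous_of_le ((Measure.le_add_left le_rfl).trans h)
  obtain ⟨u, u1, u2, u3, u4⟩ := signed_density μ lam (hp _ h1) (hn _ h1)
  choose w w1 w2 w3 w4 using fun i => signed_density (mi i) lam (hp _ (h2 i)) (hn _ (h2 i))
  have hwi : Integrable (fun x => WithLp.toLp 2 (fun i => w i x) : XX d → Euc d) lam := by
    have : Integrable (fun x => (fun i => w i x)) lam := Integrable.of_eval w2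
    exact (PiLp.continuousLinearEquiv 2 ℝ (fun _ : Fin d => ℝ)).symm.toContinuousLinearMap.integrable_comp this
  refine ⟨lam, fun x => WithLp.toLp 2 (fun i => w i x), u, hlam, ?_, u1, hwi, u2, ?_, u3, u4⟩
  · exact (WithLp.measurable_toLp 2 _).comp (measurable_pi_lambda _ w1)
  · intro s hs
    ext i
    have e1 := w3 i s hs
    have e2 := (EuclideanSpace.proj (𝕜 := ℝ) i).integral_comp_comm hwi.integrableOn (μ := lam.restrict s)
    exact (show (m s) i = _ from e1).trans e2

lemma fderiv_prod_mul {d : ℕ} (a : ℝ → ℝ) (b : Euc d → ℝ) (ha : ContDiff ℝ (⊤ : ℕ∞) a)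
    (hb : ContDiff ℝ (⊤ : ℕ∞) b) (p : XX d) (s : ℝ) (y : Euc d) :
    fderiv ℝ (fun p : XX d => a p.1 * b p.2) p (s, y) =
      s * deriv a p.1 * b p.2 + a p.1 * fderiv ℝ b p.2 y := by
  have h1 : HasFDerivAt (fun p : XX d => a p.1) ((fderiv ℝ a p.1).comp (ContinuousLinearMap.fst ℝ ℝ (Euc d))) p :=
    ((ha.differentiable (by simp)) p.1).hasFDerivAt.comp p hasFDerivAt_fst
  have h2 : HasFDerivAt (fun p : XX d => b p.2) ((fderiv ℝ b p.2).comp (ContinuousLinearMap.snd ℝ ℝ (Euc d))) p :=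
    ((hb.differentiable (by simp)) p.2).hasFDerivAt.comp p hasFDerivAt_snd
  have h3 : HasFDerivAt (fun p : XX d => a p.1 * b p.2) _ p := h1.mul h2
  rw [h3.fderiv]
  have : fderiv ℝ a p.1 s = s * deriv a p.1 := by
    rw [fderiv_eq_smul_deriv, smul_eq_mul]
  simp [this]
  ring

lemma isTest_mul {d : ℕ} (a : ℝ → ℝ) (b : Euc d → ℝ) (ha : ContDiff ℝ (⊤ : ℕ∞) a)
    (ha2 : HasCompactSupport a) (ha3 : tsupport a ⊆ Ioo 0 1)
    (hb : ContDiff ℝ (⊤ : ℕ∞) b) (hb2 : HasCompactSupport b) :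
    IsTest (fun p : XX d => a p.1 * b p.2) := by
  have hs : tsupport (fun p : XX d => a p.1 * b p.2) ⊆ tsupport a ×ˢ tsupport b := by
    refine closure_minimal ?_ ((isClosed_tsupport a).prod (isClosed_tsupport b))
    intro p hp
    exact ⟨subset_tsupport _ (left_ne_zero_of_mul hp), subset_tsupport _ (right_ne_zero_of_mul hp)⟩
  refine ⟨(ha.comp contDiff_fst).mul (hb.comp contDiff_snd), ?_, ?_⟩
  · exact (ha2.isCompact.prod hb2.isCompact).of_isClosed_subset (isClosed_tsupport _) hs
  · exact hs.trans (prod_mono ha3 (subset_univ _))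

lemma compact_bound {E : Type*} [TopologicalSpace E] {F : Type*} [NormedAddCommGroup F] (f : E → F) (hf : Continuous f) (h : HasCompactSupport f) :
    ∃ C, ∀ x, ‖f x‖ ≤ C := by
  obtain ⟨C, hC⟩ := h.exists_bound_of_continuous hf
  exact ⟨C, hC⟩

lemma mass_equation {d : ℕ} (P : Measure (XX d)) [IsFiniteMeasure P]
    (m : VectorMeasure (XX d) (Euc d)) (μ : SignedMeasure (XX d))
    (hCE : SolvesCEMeas P m μ) (φ : ℝ → ℝ) (h1 : ContDiff ℝ (⊤ : ℕ∞) φ) (h2 : HasCompactSupport φ)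
    (h3 : tsupport φ ⊆ Ioo (0:ℝ) 1) :
    ∫ x, deriv φ x.1 ∂P = - sInt μ (fun x => φ x.1) := by
  obtain ⟨lam, w, u, hl, hw, hu, hwi, hui, hdV, hdS, hs⟩ := exists_densities m μ
  let χ : ContDiffBump (0 : Euc d) := ⟨1, 2, by norm_num, by norm_num⟩
  have hdc : Continuous (deriv φ) := h1.continuous_deriv (by simp)
  obtain ⟨C0, hC0⟩ := compact_bound φ h1.continuous h2
  obtain ⟨C1, hC1⟩ := compact_bound (deriv φ) hdc h2.deriv
  have hχc : ContDiff ℝ (⊤ : ℕ∞) (χ : Euc d → ℝ) := χ.contDiff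
  obtain ⟨C2, hC2⟩ := compact_bound (fderiv ℝ χ) (hχc.continuous_fderiv (by simp)) (χ.hasCompactSupport.fderiv (𝕜 := ℝ))
  have hχ1 : ∀ x, ‖χ x‖ ≤ 1 := fun x => by
    rw [Real.norm_eq_abs, abs_of_nonneg χ.nonneg]; exact χ.le_one
  let r : ℕ → ℝ := fun n => 1 / ((n:ℝ) + 1)
  have hr0 : Tendsto r atTop (𝓝 0) := tendsto_one_div_add_atTop_nhds_zero_nat
  have hrpos : ∀ n, 0 < r n := fun n => by positivity
  have hr1 : ∀ n, r n ≤ 1 := fun n => by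
    simp only [r]; rw [div_le_one (by positivity)]; linarith [(Nat.cast_nonneg n : (0:ℝ) ≤ n)]
  let b : ℕ → Euc d → ℝ := fun n x => χ (r n • x)
  have hb : ∀ n, ContDiff ℝ (⊤ : ℕ∞) (b n) := fun n => hχc.comp (contDiff_const_smul (r n))
  have hb2 : ∀ n, HasCompactSupport (b n) := fun n =>
    χ.hasCompactSupport.comp_smul (hrpos n).ne'
  have hbd : ∀ n x y, fderiv ℝ (b n) x y = r n * fderiv ℝ χ (r n • x) y := by
    intro n x y
    have hh : HasFDerivAt (b n) ((fderiv ℝ χ (r n • x)).comp (r n • ContinuousLinearMap.id ℝ (Euc d))) x :=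
      ((hχc.differentiable (by simp)) (r n • x)).hasFDerivAt.comp x ((hasFDerivAt_id x).const_smul (r n))
    rw [hh.fderiv]
    simp
  have hb1 : ∀ x, Tendsto (fun n => b n x) atTop (𝓝 1) := by
    intro x
    have : Tendsto (fun n => r n • x) atTop (𝓝 0) := by simpa using hr0.smul_const x
    have h := (hχc.continuous.tendsto (0 : Euc d)).comp this
    rwa [χ.one_of_mem_closedBall (Metric.mem_closedBall_self (by norm_num))] at h
  have eqn : ∀ n, (∫ x : XX d, deriv φ x.1 * b n x.2 ∂P) + (∫ x : XX d, φ x.1 * fderiv ℝ (b n) x.2 (w x) ∂lam)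
      + ∫ x : XX d, (φ x.1 * b n x.2) * u x ∂lam = 0 := by
    intro n
    have := hCE lam hl w u hw hu hdV hdS _ (isTest_mul φ (b n) h1 h2 h3 (hb n) (hb2 n))
    simp_rw [fderiv_prod_mul φ (b n) h1 (hb n)] at this
    simpa using this
  have l1 : Tendsto (fun n => ∫ x : XX d, deriv φ x.1 * b n x.2 ∂P) atTop (𝓝 (∫ x : XX d, deriv φ x.1 ∂P)) := by
    refine tendsto_integral_of_dominated_convergence (fun _ => C1) ?_ (integrable_const _) ?_ ?_
    · intro n
      have := (hb n).continuous
      exact Continuous.aestronglyMeasurable (by fun_prop)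
    · intro n
      refine Eventually.of_forall fun x => ?_
      rw [norm_mul]
      exact (mul_le_of_le_one_right (norm_nonneg _) (hχ1 _)).trans (hC1 _)
    · refine Eventually.of_forall fun x => ?_
      simpa using (hb1 x.2).const_mul (deriv φ x.1)
  have l2 : Tendsto (fun n => ∫ x : XX d, φ x.1 * fderiv ℝ (b n) x.2 (w x) ∂lam) atTop (𝓝 (∫ x : XX d, 0 ∂lam)) := by
    refine tendsto_integral_of_dominated_convergence (fun x => C0 * (C2 * ‖w x‖)) ?_ ((hwi.norm.const_mul _).const_mul _) ?_ ?_
    · intro n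
      have c1 := (hb n).continuous_fderiv (by simp)
      have c2 : Measurable (fun x : XX d => fderiv ℝ (b n) x.2 (w x)) := by
        have : Continuous (fun q : XX d × Euc d => fderiv ℝ (b n) q.1.2 q.2) := by fun_prop
        exact this.measurable.comp (measurable_id.prodMk hw)
      exact ((h1.continuous.measurable.comp measurable_fst).mul c2).aestronglyMeasurable
    · intro n
      refine Eventually.of_forall fun x => ?_
      rw [norm_mul, hbd, norm_mul, Real.norm_eq_abs (r n), abs_of_pos (hrpos n)]
      have q1 := (fderiv ℝ χ (r n • x.2)).le_opNorm (w x)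
      have q2 := mul_le_mul_of_nonneg_right (hC2 (r n • x.2)) (norm_nonneg (w x))
      have q3 : r n * ‖fderiv ℝ χ (r n • x.2) (w x)‖ ≤ C2 * ‖w x‖ :=
        (mul_le_of_le_one_left (norm_nonneg _) (hr1 n)).trans (q1.trans q2)
      exact mul_le_mul (hC0 _) q3 (by have := hrpos n; positivity) ((norm_nonneg _).trans (hC0 0))
    · refine Eventually.of_forall fun x => ?_
      have : Tendsto (fun n => fderiv ℝ (b n) x.2 (w x)) atTop (𝓝 0) := by
        refine squeeze_zero_norm (a := fun n => r n * (C2 * ‖w x‖)) (fun n => ?_) (by simpa using hr0.mul_const (C2 * ‖w x‖))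
        rw [hbd, norm_mul, Real.norm_eq_abs (r n), abs_of_pos (hrpos n)]
        exact mul_le_mul_of_nonneg_left (((fderiv ℝ χ (r n • x.2)).le_opNorm (w x)).trans
          (mul_le_mul_of_nonneg_right (hC2 (r n • x.2)) (norm_nonneg (w x)))) (hrpos n).le
      simpa using this.const_mul (φ x.1)
  have l3 : Tendsto (fun n => ∫ x : XX d, (φ x.1 * b n x.2) * u x ∂lam) atTop (𝓝 (∫ x : XX d, φ x.1 * u x ∂lam)) := by
    refine tendsto_integral_of_dominated_convergence (fun x => C0 * ‖u x‖) ?_ (hui.norm.const_mul _) ?_ ?_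
    · intro n
      have := (hb n).continuous
      have c : Continuous (fun x : XX d => φ x.1 * b n x.2) := by
        have := h1.continuous
        fun_prop
      exact (c.measurable.mul hu).aestronglyMeasurable
    · intro n
      refine Eventually.of_forall fun x => ?_
      rw [norm_mul, norm_mul]
      exact mul_le_mul_of_nonneg_right ((mul_le_of_le_one_right (norm_nonneg _) (hχ1 _)).trans (hC0 _)) (norm_nonneg _)
    · refine Eventually.of_forall fun x => ?_
      simpa using ((hb1 x.2).const_mul (φ x.1)).mul_const (u x)
  have := tendsto_nhds_unique ((l1.add l2).add l3) (by simp_rw [eqn]; exact tendsto_const_nhds)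
  rw [hs (fun x => φ x.1) (h1.continuous.measurable.comp measurable_fst) ⟨C0, fun x => hC0 x.1⟩]
  simp only [integral_zero] at this
  linarith


lemma sInt_bound {d : ℕ} (μ : SignedMeasure (XX d)) (φ : XX d → ℝ) (B : ℝ) (hφ : ∀ x, |φ x| ≤ B) :
    |sInt μ φ| ≤ B * (μ.toJordanDecomposition.posPart.real univ +
      μ.toJordanDecomposition.negPart.real univ) := by
  rw [sInt, mul_add]
  refine (abs_sub _ _).trans (add_le_add ?_ ?_)
  · exact norm_integral_le_of_norm_le_const (f := φ) (C := B) (Eventually.of_forall hφ)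
  · exact norm_integral_le_of_norm_le_const (f := φ) (C := B) (Eventually.of_forall hφ)

lemma fst_bound {d : ℕ} (P : Measure (XX d)) [IsFiniteMeasure P]
    (m : VectorMeasure (XX d) (Euc d)) (μ : SignedMeasure (XX d))
    (hCE : SolvesCEMeas P m μ) : ∃ C : ℝ, ∀ ψ : ℝ → ℝ, ContDiff ℝ (⊤ : ℕ∞) ψ → HasCompactSupport ψ →
      tsupport ψ ⊆ Ioo (0:ℝ) 1 → (∀ x, 0 ≤ ψ x) → ∫ x, ψ x.1 ∂P ≤ C * ∫ t, ψ t := by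
  obtain ⟨ψ0, a1, a2, a3, a4, a5⟩ := exists_psi0
  have hint : ∀ ψ : ℝ → ℝ, ContDiff ℝ (⊤ : ℕ∞) ψ → HasCompactSupport ψ →
      Integrable (fun x : XX d => ψ x.1) P := by
    intro ψ h1 h2
    obtain ⟨C, hC⟩ := compact_bound ψ h1.continuous h2
    exact Integrable.of_bound (h1.continuous.comp continuous_fst).aestronglyMeasurable C
      (Eventually.of_forall fun x => hC x.1)
  set V := μ.toJordanDecomposition.posPart.real univ + μ.toJordanDecomposition.negPart.real univ with hV
  refine ⟨∫ x, ψ0 x.1 ∂P + 2 * V, fun ψ h1 h2 h3 h4 => ?_⟩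
  have i0 : Integrable ψ0 := a1.continuous.integrable_of_hasCompactSupport a2
  have i1 : Integrable ψ := h1.continuous.integrable_of_hasCompactSupport h2
  set I := ∫ t, ψ t with hI
  have hI0 : 0 ≤ I := integral_nonneg h4
  have hss : tsupport (fun t => ψ t - I * ψ0 t) ⊆ tsupport ψ ∪ tsupport ψ0 := by
    refine closure_minimal (fun t ht => ?_) ((isClosed_tsupport _).union (isClosed_tsupport _))
    by_contra hc
    rw [mem_union, not_or] at hc
    apply ht
    simp [image_eq_zero_of_notMem_tsupport hc.1, image_eq_zero_of_notMem_tsupport hc.2]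
  obtain ⟨φ, f1, f2, f3, f4, f5⟩ := exists_primitive (fun t => ψ t - I * ψ0 t)
    (h1.sub (contDiff_const.mul a1))
    ((h2.isCompact.union a2.isCompact).of_isClosed_subset (isClosed_tsupport _) hss)
    (hss.trans (union_subset h3 a3))
    (by rw [integral_sub i1 (i0.const_mul _), integral_const_mul, a5]; simp [hI])
  have hb : ∫ y, |ψ y - I * ψ0 y| ≤ 2 * I := by
    calc ∫ y, |ψ y - I * ψ0 y| ≤ ∫ y, (ψ y + I * ψ0 y) := by
          refine integral_mono (i1.sub (i0.const_mul _)).abs (i1.add (i0.const_mul _)) fun y => ?_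
          have := h4 y
          have := mul_nonneg hI0 (a4 y)
          simp only
          rw [abs_le]; constructor <;> linarith
      _ = 2 * I := by rw [integral_add i1 (i0.const_mul _), integral_const_mul, a5]; ring
  have h := mass_equation P m μ hCE φ f1 f2 f3
  rw [f4] at h
  have hs := sInt_bound μ (fun x => φ x.1) (2 * I) (fun x => (f5 x.1).trans hb)
  rw [integral_sub (hint ψ h1 h2) ((hint ψ0 a1 a2).const_mul _), integral_const_mul] at h
  have := neg_le_abs (sInt μ (fun x => φ x.1))
  rw [← hV] at hs
  nlinarith

lemma fst_absCont {d : ℕ} (P : Measure (XX d)) [IsFiniteMeasure P]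
    (m : VectorMeasure (XX d) (Euc d)) (μ : SignedMeasure (XX d))
    (hCE : SolvesCEMeas P m μ) (hc : P.fst (Ioo (0:ℝ) 1)ᶜ = 0) :
    P.fst ≪ volume.restrict (Ioo (0:ℝ) 1) := by
  obtain ⟨C, hC⟩ := fst_bound P m μ hCE
  refine Measure.AbsolutelyContinuous.mk fun s hs h0 => ?_
  rw [Measure.restrict_apply hs] at h0
  have e : P.fst s = P.fst (s ∩ Ioo (0:ℝ) 1) :=
    (measure_inter_conull (by rw [← hc])).symm
  rw [e]
  by_contra hne
  obtain ⟨K, hKs, hK, hKpos⟩ := (hs.inter measurableSet_Ioo).exists_lt_isCompact (pos_iff_ne_zero.2 hne)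
  have hK0 : volume K = 0 := measure_mono_null hKs h0
  have hKr : 0 < P.fst.real K := ENNReal.toReal_pos hKpos.ne' (measure_ne_top _ _)
  have key : ∀ ε : ℝ, 0 < ε → P.fst.real K ≤ |C| * ε := by
    intro ε hε
    obtain ⟨U, hKU, hU, hUε⟩ := K.exists_isOpen_lt_of_lt (μ := volume) (ENNReal.ofReal ε) (by rw [hK0]; simpa using hε)
    obtain ⟨K', hK', hKK', hK'U⟩ := exists_compact_between hK (hU.inter isOpen_Ioo)
      (subset_inter hKU (hKs.trans inter_subset_right))
    obtain ⟨f, f1, f2, f3⟩ := exists_contMDiffMap_one_nhds_of_subset_interior (modelWithCornersSelf ℝ ℝ) (n := (⊤ : ℕ∞)) hK.isClosed hKK'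
    have hfs : tsupport f ⊆ K' := closure_minimal (fun x hx => by
      by_contra hc
      exact hx (f2 x hc)) hK'.isClosed
    have hfc : ContDiff ℝ (⊤ : ℕ∞) f := f.contMDiff.contDiff
    have hf2 : HasCompactSupport f := hK'.of_isClosed_subset (isClosed_tsupport _) hfs
    have q := hC f hfc hf2 (hfs.trans (hK'U.trans inter_subset_right)) (fun x => (f3 x).1)
    have q1 : P.fst.real K ≤ ∫ x, f x.1 ∂P := by
      have : ∫ x, f x.1 ∂P = ∫ t, f t ∂P.fst := by
        rw [Measure.fst, integral_map measurable_fst.aemeasurable hfc.continuous.aestronglyMeasurable]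
      rw [this, ← integral_indicator_one hK.measurableSet]
      refine integral_mono ((integrable_const (1:ℝ)).indicator hK.measurableSet) ?_ fun x => ?_
      · exact Integrable.of_bound hfc.continuous.aestronglyMeasurable 1
          (Eventually.of_forall fun x => by
            have h := f3 x
            rw [Real.norm_eq_abs, abs_of_nonneg h.1]; exact h.2)
      · by_cases hx : x ∈ K
        · have := f1.self_of_nhdsSet x hx
          simp [hx, this]
        · simpa [hx] using (f3 x).1
    have q2 : ∫ t, f t ≤ ε := by
      have hUv : volume.real U ≤ ε := ENNReal.toReal_le_of_le_ofReal hε.le hUε.le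
      refine le_trans ?_ hUv
      rw [← integral_indicator_one hU.measurableSet]
      refine integral_mono (hfc.continuous.integrable_of_hasCompactSupport hf2) ?_ fun x => ?_
      · exact (integrable_indicator_iff hU.measurableSet).2 (integrableOn_const (hUε.trans ENNReal.ofReal_lt_top).ne)
      · by_cases hx : x ∈ U
        · simpa [hx] using (f3 x).2
        · simp [hx, f2 x (fun h => hx (hK'U h).1)]
    have q3 : 0 ≤ ∫ t, f t := integral_nonneg fun x => (f3 x).1
    calc P.fst.real K ≤ C * ∫ t, f t := q1.trans q
      _ ≤ |C| * ∫ t, f t := mul_le_mul_of_nonneg_right (le_abs_self C) q3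
      _ ≤ _ := mul_le_mul_of_nonneg_left q2 (abs_nonneg C)
  have := key (P.fst.real K / (2 * (|C| + 1))) (by positivity)
  have h2 : |C| * (P.fst.real K / (2 * (|C| + 1))) < P.fst.real K := by
    rw [mul_div_assoc', div_lt_iff₀ (by positivity)]
    nlinarith [abs_nonneg C]
  linarith

open ProbabilityTheory in
lemma exists_kernel {d : ℕ} (P : Measure (XX d)) [IsFiniteMeasure P]
    (hac : P.fst ≪ volume.restrict (Ioo (0:ℝ) 1)) :
    ∃ κ : Kernel ℝ (Euc d), IsSFiniteKernel κ ∧ (∀ t, IsFiniteMeasure (κ t)) ∧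
      P = (volume.restrict (Ioo (0:ℝ) 1)) ⊗ₘ κ := by
  set V := (volume : Measure ℝ).restrict (Ioo (0:ℝ) 1) with hV
  let f : ℝ → ℝ≥0 := fun t => (P.fst.rnDeriv V t).toNNReal
  have hf : Measurable f := (Measure.measurable_rnDeriv _ _).ennreal_toNNReal
  have hf' : Measurable (Function.uncurry fun (t : ℝ) (_ : Euc d) => (f t : ℝ≥0∞)) :=
    (hf.comp measurable_fst).coe_nnreal_ennreal
  let κ : Kernel ℝ (Euc d) := Kernel.withDensity P.condKernel (fun t _ => (f t : ℝ≥0∞))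
  have hκ : ∀ t, κ t = (f t : ℝ≥0∞) • P.condKernel t := fun t => by
    simp only [κ]
    rw [Kernel.withDensity_apply _ hf', withDensity_const]
  refine ⟨κ, inferInstance, fun t => by
    rw [hκ]; exact (P.condKernel t).smul_finite ENNReal.coe_ne_top, ?_⟩
  have : IsSFiniteKernel κ := inferInstance
  ext s hs
  conv_lhs => rw [← P.disintegrate P.condKernel]
  rw [Measure.compProd_apply hs, Measure.compProd_apply hs]
  rw [← lintegral_rnDeriv_mul hac (Kernel.measurable_kernel_prodMk_left hs).aemeasurable]
  refine lintegral_congr_ae ?_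
  filter_upwards [Measure.rnDeriv_lt_top P.fst V] with t ht
  rw [hκ]
  simp [f, ENNReal.coe_toNNReal ht.ne]


open ProbabilityTheory in
lemma weak_part {d : ℕ} (P : Measure (XX d)) [IsFiniteMeasure P]
    (m : VectorMeasure (XX d) (Euc d)) (μ : SignedMeasure (XX d))
    (hCE : SolvesCEMeas P m μ) (κ : Kernel ℝ (Euc d)) [IsSFiniteKernel κ]
    (hP : P = (volume.restrict (Ioo (0:ℝ) 1)) ⊗ₘ κ)
    (v : XX d → Euc d) (g : XX d → ℝ) (hv : Measurable v) (hg : Measurable g)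
    (hm : ∀ s, MeasurableSet s → m s = ∫ x in s, v x ∂P)
    (hμ : ∀ s, MeasurableSet s → μ s = ∫ x in s, g x ∂P)
    (hi : (∫⁻ x, ENNReal.ofReal (‖v x‖ + |g x|) ∂P) < ⊤)
    (ζ : Euc d → ℝ) (hζ : ContDiff ℝ (⊤ : ℕ∞) ζ) (hζ2 : HasCompactSupport ζ) :
    ∃ F : ℝ → ℝ, ContinuousOn F (Icc 0 1) ∧
      ∀ᵐ t ∂(volume.restrict (Ioo (0:ℝ) 1)), ∫ x, ζ x ∂(κ t) = F t := by
  have hvg : Integrable (fun x => ‖v x‖ + |g x|) P := by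
    refine ⟨(hv.norm.add hg.abs).aestronglyMeasurable, ?_⟩
    rwa [hasFiniteIntegral_iff_ofReal (Eventually.of_forall fun x => by positivity)]
  have hvi : Integrable v P := hvg.mono' hv.aestronglyMeasurable
    (Eventually.of_forall fun x => le_add_of_nonneg_right (abs_nonneg _))
  have hgi : Integrable g P := hvg.mono' hg.aestronglyMeasurable
    (Eventually.of_forall fun x => le_add_of_nonneg_left (norm_nonneg _))
  obtain ⟨C0, hC0⟩ := compact_bound ζ hζ.continuous hζ2
  have hζd : Continuous (fderiv ℝ ζ) := hζ.continuous_fderiv (by simp)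
  obtain ⟨C1, hC1⟩ := compact_bound (fderiv ℝ ζ) hζd (hζ2.fderiv (𝕜 := ℝ))
  have hζm : Measurable (fun x : XX d => ζ x.2) := (hζ.continuous.comp continuous_snd).measurable
  have j1 : Integrable (fun x : XX d => ζ x.2) P :=
    Integrable.of_bound hζm.aestronglyMeasurable C0 (Eventually.of_forall fun x => hC0 x.2)
  have c2 : Measurable (fun x : XX d => fderiv ℝ ζ x.2 (v x)) := by
    have : Continuous (fun q : XX d × Euc d => fderiv ℝ ζ q.1.2 q.2) := by fun_prop
    exact this.measurable.comp (measurable_id.prodMk hv)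
  have j2 : Integrable (fun x : XX d => fderiv ℝ ζ x.2 (v x)) P := by
    refine (hvi.norm.const_mul C1).mono' c2.aestronglyMeasurable (Eventually.of_forall fun x => ?_)
    exact ((fderiv ℝ ζ x.2).le_opNorm (v x)).trans (mul_le_mul_of_nonneg_right (hC1 _) (norm_nonneg _))
  have j3 : Integrable (fun x : XX d => ζ x.2 * g x) P :=
    hgi.bdd_mul (c := C0) hζm.aestronglyMeasurable (Eventually.of_forall fun x => hC0 x.2)
  have j4 := j2.add j3
  have k1 : IntegrableOn (fun t => ∫ x, ζ x ∂(κ t)) (Ioo (0:ℝ) 1) := by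
    rw [hP] at j1
    exact Integrable.integral_compProd (κ := Kernel.const Unit (volume.restrict (Ioo (0:ℝ) 1))) (η := Kernel.prodMkLeft Unit κ) (a := ()) j1
  have k2 : IntegrableOn (fun t => ∫ x, (fderiv ℝ ζ x (v (t, x)) + ζ x * g (t, x)) ∂(κ t)) (Ioo (0:ℝ) 1) := by
    rw [hP] at j4
    exact Integrable.integral_compProd (κ := Kernel.const Unit (volume.restrict (Ioo (0:ℝ) 1))) (η := Kernel.prodMkLeft Unit κ) (a := ()) j4
  refine weak_deriv_ae_eq _ _ k1 k2 fun φ h1 h2 h3 => ?_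
  have hdc : Continuous (deriv φ) := h1.continuous_deriv (by simp)
  obtain ⟨B0, hB0⟩ := compact_bound φ h1.continuous h2
  obtain ⟨B1, hB1⟩ := compact_bound (deriv φ) hdc h2.deriv
  have hb : ∀ (a : ℝ → ℝ) (B : ℝ), Continuous a → (∀ x, ‖a x‖ ≤ B) → ∀ k : XX d → ℝ, Integrable k P →
      Integrable (fun x : XX d => a x.1 * k x) P := fun a B ha hB k hk =>
    hk.bdd_mul (c := B) (ha.comp continuous_fst).aestronglyMeasurable (Eventually.of_forall fun x => hB x.1)
  have hh : ∀ (a : ℝ → ℝ) (B : ℝ), Continuous a → (∀ x, ‖a x‖ ≤ B) → ∀ k : XX d → ℝ, Integrable k P →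
      ∫ t in Ioo (0:ℝ) 1, a t * ∫ x, k (t, x) ∂(κ t) = ∫ x, a x.1 * k x ∂P := by
    intro a B ha hB k hk
    have := hb a B ha hB k hk
    rw [hP] at this
    conv_rhs => rw [hP]
    rw [Measure.integral_compProd this]
    simp_rw [integral_const_mul]
  have e1 := hh _ _ hdc hB1 _ j1
  have e2 := hh _ _ h1.continuous hB0 _ j4
  simp only [Pi.add_apply] at e1 e2
  rw [e1, e2]
  have := hCE P inferInstance v g hv hg hm hμ _ (isTest_mul φ ζ h1 h2 h3 hζ hζ2)
  simp_rw [fderiv_prod_mul φ ζ h1 hζ] at this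
  simp only [map_zero, mul_zero, add_zero, one_mul, zero_mul, zero_add] at this
  simp_rw [mul_add]
  rw [integral_add (hb _ _ h1.continuous hB0 _ j2) (hb _ _ h1.continuous hB0 _ j3)]
  simp_rw [mul_assoc] at this
  linarith

open ProbabilityTheory in
lemma narrow_part {d : ℕ} (Ω : Set (Euc d)) (hΩ : IsCompact Ω)
    (κ : ℝ → Measure (Euc d)) (hfin : ∀ t, IsFiniteMeasure (κ t))
    (hc : ∀ᵐ t ∂(volume.restrict (Ioo (0:ℝ) 1)), κ t Ωᶜ = 0)
    (hw : ∀ ζ : Euc d → ℝ, ContDiff ℝ (⊤ : ℕ∞) ζ → HasCompactSupport ζ →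
      ∃ F : ℝ → ℝ, ContinuousOn F (Icc 0 1) ∧
      ∀ᵐ t ∂(volume.restrict (Ioo (0:ℝ) 1)), ∫ x, ζ x ∂(κ t) = F t) :
    ∃ ρ', NarrowCurve Ω ρ' ∧ ∀ᵐ t ∂(volume.restrict (Ioo (0:ℝ) 1)), κ t = ρ' t := by
  obtain ⟨D, hDc, hD, ⟨ζ1, hζ1, hζ1'⟩, hDd⟩ := exists_countable_smooth_dense Ω hΩ
  choose! F hF hF' using fun ζ (hζ : ζ ∈ D) => hw ζ (hD ζ hζ).1 (hD ζ hζ).2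
  have hae : ∀ᵐ t ∂(volume.restrict (Ioo (0:ℝ) 1)),
      t ∈ Ioo (0:ℝ) 1 ∧ κ t Ωᶜ = 0 ∧ ∀ ζ ∈ D, ∫ x, ζ x ∂(κ t) = F ζ t := by
    filter_upwards [ae_restrict_mem measurableSet_Ioo, hc, (ae_ball_iff hDc).2 hF'] with t a b c
    exact ⟨a, b, c⟩
  let T : Set ℝ := {t | t ∈ Ioo (0:ℝ) 1 ∧ κ t Ωᶜ = 0 ∧ ∀ ζ ∈ D, ∫ x, ζ x ∂(κ t) = F ζ t}
  have hT : Icc (0:ℝ) 1 ⊆ closure T := by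
    rw [← closure_Ioo (by norm_num : (0:ℝ) ≠ 1)]
    refine closure_minimal (fun t ht => ?_) isClosed_closure
    rw [mem_closure_iff]
    intro o ho hto
    by_contra hne
    have h0 : (volume.restrict (Ioo (0:ℝ) 1)) o = 0 :=
      measure_mono_null (fun s hs hs' => hne ⟨s, hs, hs'⟩) hae
    rw [Measure.restrict_apply ho.measurableSet] at h0
    exact (ho.inter isOpen_Ioo).measure_pos volume ⟨t, hto, ht⟩ |>.ne' h0
  have hT' : T ⊆ Icc 0 1 := fun t ht => Ioo_subset_Icc_self ht.1
  have : CompactSpace Ω := isCompact_iff_compactSpace.1 hΩ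
  have hΩm : MeasurableSet Ω := hΩ.isClosed.measurableSet
  have hemb : MeasurableEmbedding (Subtype.val : Ω → Euc d) := MeasurableEmbedding.subtype_coe hΩm
  let lam : ℝ → Measure Ω := fun t => (κ t).comap Subtype.val
  have hmap : ∀ t ∈ T, (lam t).map Subtype.val = κ t := by
    intro t ht
    simp only [lam]
    rw [hemb.map_comap, Subtype.range_coe]
    refine Measure.restrict_eq_self_of_ae_mem ?_
    exact ht.2.1
  have hint : ∀ t ∈ T, ∀ ζ : Euc d → ℝ, ∫ x, ζ x ∂(κ t) = ∫ x : Ω, ζ x ∂(lam t) := by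
    intro t ht ζ
    rw [← hmap t ht, hemb.integral_map]
  obtain ⟨M, hM⟩ := isCompact_Icc.exists_bound_of_continuousOn (hF ζ1 hζ1)
  have hlf : ∀ t, IsFiniteMeasure (lam t) := fun t => by
    refine ⟨?_⟩
    simp only [lam]
    rw [hemb.comap_apply]
    exact measure_lt_top _ _
  have p1 : ∀ t ∈ T, (lam t).real univ ≤ M := by
    intro t ht
    have e := hint t ht ζ1
    have e2 : ∫ x : Ω, ζ1 x ∂(lam t) = (lam t).real univ := by
      have e3 : ∀ x : Ω, ζ1 x = 1 := fun x => hζ1' x x.2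
      simp [e3]
    rw [← e2, ← e, ht.2.2 ζ1 hζ1]
    exact (le_abs_self _).trans (hM t (hT' ht))
  have p2 : ∀ f ∈ {f : C(Ω, ℝ) | ∃ ζ ∈ D, ∀ x : Ω, f x = ζ x}, ∃ F : ℝ → ℝ, ContinuousOn F (Icc 0 1) ∧
      ∀ t ∈ T, ∫ x, f x ∂(lam t) = F t := by
    rintro f ⟨ζ, hζ, hf⟩
    refine ⟨F ζ, hF ζ hζ, fun t ht => ?_⟩
    simp_rw [hf]
    rw [← hint t ht, ht.2.2 ζ hζ]
  obtain ⟨ρ, r1, r2, r3⟩ := narrow_extension lam T hT hT' (fun t _ => hlf t) M p1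
    {f : C(Ω, ℝ) | ∃ ζ ∈ D, ∀ x : Ω, f x = ζ x} hDd p2
  · refine ⟨fun t => (ρ t).map Subtype.val, ⟨fun t ht => ⟨?_, ?_⟩, fun φ hφ => ?_⟩, ?_⟩
    · rw [hemb.map_apply]; simp
    · have := r1 t ht
      exact measure_ne_top _ _
    · have := r2 ⟨fun x : Ω => φ x, hφ.comp continuous_subtype_val⟩
      simpa [hemb.integral_map] using this
    · filter_upwards [hae] with t ht
      rw [← r3 t ht, hmap t ht]

/-- **Properties of measure solutions of the continuity equation.**
If `(ρ, m, μ) ∈ M_Ω` solves `∂ₜ ρ + div m = μ` with `ρ ∈ M⁺(X_Ω)`, then `ρ`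
disintegrates as `ρ = dt ⊗ ρ_t` with `ρ_t ∈ M⁺(Ω)` a.e., the mass `t ↦ ρ_t(Ω)`
has distributional derivative `π_# μ` (hence is `BV(0,1)`), and if moreover
`m = vρ`, `μ = gρ` with `∫₀¹∫ (|v|+|g|) dρ_t dt < ∞` then `ρ_t` has a narrowly
continuous representative. -/
theorem continuity_equation_properties (d : ℕ) (hd : 1 ≤ d) (Ω : Set (Euc d))
    (hΩ : IsClosureOfBoundedDomain Ω)
    (P : Measure (XX d)) (hPfin : IsFiniteMeasure P)
    (hPconc : P ((Ioo (0:ℝ) 1 ×ˢ Ω)ᶜ) = 0)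
    (m : VectorMeasure (XX d) (Euc d)) (μ : SignedMeasure (XX d))
    (hCE : SolvesCEMeas P m μ) :
    ∃ ν : ℝ → Measure (Euc d),
      (∀ s : Set (XX d), MeasurableSet s →
        Measurable fun t => ν t {x | (t, x) ∈ s}) ∧
      (∀ s : Set (XX d), MeasurableSet s →
        P s = ∫⁻ t in Ioo (0:ℝ) 1, ν t {x | (t, x) ∈ s}) ∧
      (∀ᵐ t ∂(volume.restrict (Ioo (0:ℝ) 1)), ν t Ωᶜ = 0 ∧ ν t Set.univ ≠ ⊤) ∧
      (∀ φ : ℝ → ℝ, ContDiff ℝ (⊤ : ℕ∞) φ → HasCompactSupport φ →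
        tsupport φ ⊆ Ioo (0:ℝ) 1 →
        (∫ t in Ioo (0:ℝ) 1, deriv φ t * (ν t Set.univ).toReal)
          = - sInt μ (fun x => φ x.1)) ∧
      (∀ (v : XX d → Euc d) (g : XX d → ℝ), Measurable v → Measurable g →
        (∀ s : Set (XX d), MeasurableSet s → m s = ∫ x in s, v x ∂P) →
        (∀ s : Set (XX d), MeasurableSet s → μ s = ∫ x in s, g x ∂P) →
        (∫⁻ x, ENNReal.ofReal (‖v x‖ + |g x|) ∂P) < ⊤ →
        ∃ ρ' : ℝ → Measure (Euc d), NarrowCurve Ω ρ' ∧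
          ∀ᵐ t ∂(volume.restrict (Ioo (0:ℝ) 1)), ν t = ρ' t) := by
  have hPf := hPfin
  have hΩc : IsCompact Ω := by
    obtain ⟨U, -, -, -, hb, rfl⟩ := hΩ
    exact hb.isCompact_closure
  have hfst : P.fst (Ioo (0:ℝ) 1)ᶜ = 0 := by
    rw [Measure.fst_apply measurableSet_Ioo.compl]
    refine measure_mono_null ?_ hPconc
    exact fun x hx h => hx h.1
  obtain ⟨κ, hκ, hκf, hP⟩ := exists_kernel P (fst_absCont P m μ hCE hfst)
  have hdis : ∀ s : Set (XX d), MeasurableSet s →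
        P s = ∫⁻ t in Ioo (0:ℝ) 1, κ t {x | (t, x) ∈ s} := fun s hs => by
    conv_lhs => rw [hP]
    rw [Measure.compProd_apply hs]
    rfl
  have hmeas : ∀ s : Set (XX d), MeasurableSet s → Measurable fun t => κ t {x | (t, x) ∈ s} :=
    fun s hs => ProbabilityTheory.Kernel.measurable_kernel_prodMk_left hs
  have hconc : ∀ᵐ t ∂(volume.restrict (Ioo (0:ℝ) 1)), κ t Ωᶜ = 0 := by
    have hms : MeasurableSet ((univ : Set ℝ) ×ˢ Ωᶜ) :=
      MeasurableSet.univ.prod hΩc.isClosed.measurableSet.compl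
    have h0 : P ((univ : Set ℝ) ×ˢ Ωᶜ) = 0 :=
      measure_mono_null (t := (Ioo (0:ℝ) 1 ×ˢ Ω)ᶜ) (fun x hx h => hx.2 h.2) hPconc
    rw [hdis _ hms, lintegral_eq_zero_iff (hmeas _ hms)] at h0
    filter_upwards [h0] with t ht
    refine Eq.trans ?_ ht
    congr 1
    ext x
    exact ⟨fun h => ⟨mem_univ _, h⟩, fun h => h.2⟩
  refine ⟨κ, hmeas, hdis, ?_, ?_, ?_⟩
  · filter_upwards [hconc] with t ht
    exact ⟨ht, measure_ne_top _ _⟩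
  · intro φ h1 h2 h3
    rw [← mass_equation P m μ hCE φ h1 h2 h3]
    have hdc : Continuous (deriv φ) := h1.continuous_deriv (by simp)
    obtain ⟨B1, hB1⟩ := compact_bound (deriv φ) hdc h2.deriv
    have hi : Integrable (fun x : XX d => deriv φ x.1) P :=
      Integrable.of_bound (hdc.comp continuous_fst).aestronglyMeasurable B1
        (Eventually.of_forall fun x => hB1 x.1)
    rw [hP] at hi
    conv_rhs => rw [hP]
    rw [Measure.integral_compProd hi]
    refine integral_congr_ae (Eventually.of_forall fun t => ?_)
    simp [Measure.real, mul_comm]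
  · intro v g hv hg hm hμ hi
    exact narrow_part Ω hΩc κ hκf hconc fun ζ hζ hζ2 =>
      weak_part P m μ hCE κ hP v g hv hg hm hμ hi ζ hζ hζ2

end Paper
end
end
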